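/- Generalised quantum Sanov theorem revisited (i.i.d. alternative). Let ℋ = ℂ^d be a finite-dimensional Hilbert space, let 𝒜 = (𝒜_n)_n be a sequence of topologically closed, convex sets 𝒜_n ⊆ 𝒟(ℋ^{⊗n}) satisfying Axioms Q.I–Q.IV, and let ℬ₁ ⊆ 𝒟(ℋ) be a non-empty topologically closed set of states. Then Stein(𝒜‖ℬ₁^{iid}) = min*_{μ∈𝒫(ℬ₁)} lim_{n→∞} (1/n) inf_{ρ_n∈𝒜_n} D(ρ_n ‖ ∫_{ℬ₁} dμ(σ) σ^{⊗n}), where the minimum is restricted to those μ for which the inner limit in n exists, and this restricted set is non-empty with the minimum attained. -/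

import Mathlib

open Filter MeasureTheory Topology
open scoped BigOperators Classical ComplexOrder

noncomputable section

namespace QSanov

/-- Matrices representing operators on the single-copy Hilbert space with orthonormal
basis indexed by `ι`. -/
abbrev MatC (ι : Type*) := Matrix ι ι ℂ

/-- Matrices representing operators on the `n`-fold tensor power Hilbert space. -/
abbrev MatN (ι : Type*) (n : ℕ) := Matrix (Fin n → ι) (Fin n → ι) ℂ

instance matMeasurableSpace (m n : Type*) : MeasurableSpace (Matrix m n ℂ) :=
  inferInstanceAs (MeasurableSpace (m → n → ℂ))

/-- A quantum state: a positive semidefinite matrix of trace one. -/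
def IsState {κ : Type*} [Fintype κ] (ρ : Matrix κ κ ℂ) : Prop :=
  ρ.PosSemidef ∧ ρ.trace = 1

/-- Loewner order: `A ≤ B` iff `B - A` is positive semidefinite. -/
def loewnerLE {κ : Type*} [Fintype κ] (A B : Matrix κ κ ℂ) : Prop :=
  (B - A).PosSemidef

/-- The `n`-fold tensor power `ρ^{⊗n}` of a single-copy matrix. -/
def tensorPow {ι : Type*} (ρ : MatC ι) (n : ℕ) : MatN ι n :=
  fun i j => ∏ k, ρ (i k) (j k)

/-- The tensor product `ρ₁ ⊗ ⋯ ⊗ ρ_n` of a family of single-copy matrices. -/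
def tensorProdFam {ι : Type*} {n : ℕ} (ρ : Fin n → MatC ι) : MatN ι n :=
  fun i j => ∏ k, ρ k (i k) (j k)

/-- The tensor product of an `n`-copy matrix and an `m`-copy matrix. -/
def tensorMul {ι : Type*} {n m : ℕ} (ρ : MatN ι n) (σ : MatN ι m) : MatN ι (n + m) :=
  fun i j => ρ (fun t => i (Fin.castAdd m t)) (fun t => j (Fin.castAdd m t)) *
    σ (fun t => i (Fin.natAdd n t)) (fun t => j (Fin.natAdd n t))

/-- Conjugation `U_π ρ U_π†` by the unitary permuting the `n` tensor factors. -/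
def permCopies {ι : Type*} {n : ℕ} (π : Equiv.Perm (Fin n)) (ρ : MatN ι n) : MatN ι n :=
  fun i j => ρ (i ∘ π) (j ∘ π)

/-- Matrix logarithm via functional calculus on the support (eigenvalue `0` is sent
to `0`, since `Real.log 0 = 0`). -/
def matLog {κ : Type*} [Fintype κ] [DecidableEq κ] (A : Matrix κ κ ℂ) : Matrix κ κ ℂ :=
  if hA : A.IsHermitian then
    (hA.eigenvectorUnitary : Matrix κ κ ℂ) *
      (Matrix.diagonal fun i => (Real.log (hA.eigenvalues i) : ℂ)) *
      (star (hA.eigenvectorUnitary : Matrix κ κ ℂ))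
  else 0

/-- Support inclusion `supp ρ ⊆ supp σ`, phrased as inclusion of ranges. -/
def suppLE {κ : Type*} [Fintype κ] [DecidableEq κ] (ρ σ : Matrix κ κ ℂ) : Prop :=
  LinearMap.range (Matrix.toLin' ρ) ≤ LinearMap.range (Matrix.toLin' σ)

/-- Umegaki relative entropy `D(ρ‖σ) = Tr[ρ (log ρ - log σ)]`, equal to `+∞` when
`supp ρ ⊄ supp σ`. -/
def relEnt {κ : Type*} [Fintype κ] [DecidableEq κ] (ρ σ : Matrix κ κ ℂ) : EReal :=
  if suppLE ρ σ then (((ρ * (matLog ρ - matLog σ)).trace.re : ℝ) : EReal) else ⊤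

/-- Relative entropy between two sets of states: `D(𝒜‖ℬ) = inf_{ρ∈𝒜, σ∈ℬ} D(ρ‖σ)`. -/
def relEntSet {κ : Type*} [Fintype κ] [DecidableEq κ] (A B : Set (Matrix κ κ ℂ)) : EReal :=
  ⨅ ρ ∈ A, ⨅ σ ∈ B, relEnt ρ σ

/-- The composite i.i.d. hypothesis `𝒻₁^{⊗n, iid}` built on the base set `F1`. -/
def iidSet {ι : Type*} (F1 : Set (MatC ι)) (n : ℕ) : Set (MatN ι n) :=
  {ρ | ∃ σ ∈ F1, ρ = tensorPow σ n}

/-- The arbitrarily varying hypothesis `𝒻₁^{⊗n, av}` built on the base set `F1`. -/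
def avSet {ι : Type*} (F1 : Set (MatC ι)) (n : ℕ) : Set (MatN ι n) :=
  {ρ | ∃ f : Fin n → MatC ι, (∀ p, f p ∈ F1) ∧ ρ = tensorProdFam f}

/-- Worst-case type II error probability `β_ε(A‖B)` for a threshold `ε` on the
worst-case type I error probability. -/
def typeII {κ : Type*} [Fintype κ] [DecidableEq κ] (A B : Set (Matrix κ κ ℂ)) (ε : ℝ) : ℝ :=
  sInf {b : ℝ | ∃ E : Matrix κ κ ℂ, E.PosSemidef ∧ (1 - E).PosSemidef ∧
    (∀ ρ ∈ A, (ρ * (1 - E)).trace.re ≤ ε) ∧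
    b = sSup {x : ℝ | ∃ σ ∈ B, x = (σ * E).trace.re}}

/-- `- log x`, with value `+∞` for `x ≤ 0`. -/
def negLog (x : ℝ) : EReal := if x ≤ 0 then ⊤ else ((-Real.log x : ℝ) : EReal)

/-- `(1/n : EReal)`. -/
def cFrac (n : ℕ) : EReal := (((n : ℝ)⁻¹ : ℝ) : EReal)

/-- The Stein exponent `Stein(𝒜‖ℬ) = lim_{ε→0⁺} liminf_n -(1/n) log β_ε(𝒜_n‖ℬ_n)`;
since the inner quantity is monotone nondecreasing in `ε`, the limit as `ε → 0⁺`
coincides with the infimum over `ε ∈ (0,1)`. -/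
def steinExponent {ι : Type*} [Fintype ι] [DecidableEq ι]
    (A B : ∀ n : ℕ, Set (MatN ι n)) : EReal :=
  ⨅ ε ∈ Set.Ioo (0 : ℝ) 1,
    Filter.liminf (fun n : ℕ => cFrac n * negLog (typeII (A n) (B n) ε)) Filter.atTop

/-- The mixture `∫ dμ(σ) σ^{⊗n}` of i.i.d. states along a measure `μ` on a set of
states `C` (Bochner integral, computed entrywise). -/
def iidMix {ι : Type*} {C : Set (MatC ι)} (μ : Measure ↥C) (n : ℕ) : MatN ι n :=
  fun i j => ∫ σ, (∏ k, (σ : MatC ι) (i k) (j k)) ∂μ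

/-- The `b`-th block of size `k` of an index of `ℋ^{⊗ mk}`. -/
def blockOf {ι : Type*} {m k : ℕ} (i : Fin (m * k) → ι) (b : Fin m) : Fin k → ι :=
  fun t => i (finProdFinEquiv (b, t))

/-- Replace the blocks in `S` of the index `i` by the values prescribed by `c`. -/
def mergeBlocks {ι : Type*} {m k : ℕ} (S : Finset (Fin m)) (c : Fin m → Fin k → ι)
    (i : Fin (m * k) → ι) : Fin (m * k) → ι :=
  fun p => if (finProdFinEquiv.symm p).1 ∈ S
    then c (finProdFinEquiv.symm p).1 (finProdFinEquiv.symm p).2 else i p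

/-- Entry `(i,j)` of the partial trace of `ρ` over the blocks in `S`
(the remaining blocks being evaluated at `i`, `j`). -/
def blockPartialTrace {ι : Type*} [Fintype ι] {m k : ℕ} (S : Finset (Fin m))
    (ρ : MatN ι (m * k)) (i j : Fin (m * k) → ι) : ℂ :=
  (((Fintype.card ι : ℂ) ^ (k * (m - S.card)))⁻¹) *
    ∑ c : Fin m → Fin k → ι, ρ (mergeBlocks S c i) (mergeBlocks S c j)

/-- The `m`-fold tensor power `(𝒩^δ_ω)^{⊗ m}` of the depolarising channel
`𝒩^δ_ω(X) = (1-δ) X + δ Tr[X] ω`, acting blockwise on blocks of `k` tensor factors. -/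
def blockDepolarize {ι : Type*} [Fintype ι] (δ : ℝ) {k : ℕ} (ω : MatN ι k) (m : ℕ)
    (ρ : MatN ι (m * k)) : MatN ι (m * k) :=
  fun i j => ∑ S : Finset (Fin m),
    (((1 - δ) ^ (m - S.card) * δ ^ S.card : ℝ) : ℂ) *
      ((∏ b ∈ S, ω (blockOf i b) (blockOf j b)) * blockPartialTrace S ρ i j)

/-- The `m`-fold tensor power of a `k`-copy matrix, as an `mk`-copy matrix. -/
def powBlocks {ι : Type*} {k : ℕ} (ρ : MatN ι k) (m : ℕ) : MatN ι (m * k) :=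
  fun i j => ∏ b : Fin m, ρ (blockOf i b) (blockOf j b)

/-- `Tr_{n+1,…,n+k}[ρ (𝟙^{⊗n} ⊗ F)]`, the filtered reduction of an `(n+k)`-copy matrix. -/
def condReduce {ι : Type*} [Fintype ι] {n k : ℕ} (ρ : MatN ι (n + k)) (F : MatN ι k) :
    MatN ι n :=
  fun i j => ∑ a : Fin k → ι, ∑ b : Fin k → ι,
    ρ (Fin.append i a) (Fin.append j b) * F b a

/-- Partial trace over the `k`-th tensor factor. -/
def traceOutAt {ι : Type*} [Fintype ι] {n : ℕ} (k : Fin (n + 1)) (σ : MatN ι (n + 1)) :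
    MatN ι n :=
  fun i j => ∑ a : ι, σ (k.insertNth a i) (k.insertNth a j)

/-- Insert the single-copy state `τ` at position `k` into an `n`-copy matrix. -/
def insertState {ι : Type*} {n : ℕ} (k : Fin (n + 1)) (τ : MatC ι) (σ : MatN ι n) :
    MatN ι (n + 1) :=
  fun i j => τ (i k) (j k) *
    σ (fun t => i (k.succAbove t)) (fun t => j (k.succAbove t))

/-- Product of a state on `A^n` and a state on `B^n`, viewed as a state on
`(ℋ_A ⊗ ℋ_B)^{⊗ n}` (reordering tensor factors implicitly). -/
def prodStateAB {ιA ιB : Type*} {n : ℕ} (α : Matrix (Fin n → ιA) (Fin n → ιA) ℂ)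
    (β : Matrix (Fin n → ιB) (Fin n → ιB) ℂ) : MatN (ιA × ιB) n :=
  fun i j => α (fun k => (i k).1) (fun k => (j k).1) * β (fun k => (i k).2) (fun k => (j k).2)


/-- The set `𝒮_{A^n:B^n}` of separable states across the cut `A^n : B^n`. -/
def sepSet (ιA ιB : Type*) [Fintype ιA] [Fintype ιB] (n : ℕ) : Set (MatN (ιA × ιB) n) :=
  convexHull ℝ {ρ | ∃ α β, IsState α ∧ IsState β ∧ ρ = prodStateAB α β}

/-- Classical relative entropy of two finitely supported output distributions. -/
def clRelEnt {m : ℕ} (P Q : Fin m → ℝ) : EReal :=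
  ∑ x, (if P x = 0 then (0 : EReal) else if Q x = 0 then (⊤ : EReal)
    else ((P x * Real.log (P x / Q x) : ℝ) : EReal))

/-- Measured relative entropy: supremum over all finite POVMs of the classical
relative entropy of the induced outcome distributions. -/
def measuredRelEnt {κ : Type*} [Fintype κ] [DecidableEq κ] (ρ σ : Matrix κ κ ℂ) : EReal :=
  ⨆ (m : ℕ) (E : Fin m → Matrix κ κ ℂ) (_ : ∀ x, (E x).PosSemidef) (_ : ∑ x, E x = 1),
    clRelEnt (fun x => (ρ * E x).trace.re) (fun x => (σ * E x).trace.re)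


/-- Axiom Q.I: there is a full-support free state `τ ∈ 𝒜₁` such that every `𝒜_{mk}`
is stable under blockwise depolarising towards `τ^{⊗k}`. -/
def AxiomQI {ι : Type*} [Fintype ι] [DecidableEq ι] (A : ∀ n : ℕ, Set (MatN ι n)) : Prop :=
  ∃ τ : MatC ι, tensorPow τ 1 ∈ A 1 ∧
    ∀ m k : ℕ, 1 ≤ m → 1 ≤ k → ∀ ρ ∈ A (m * k),
      suppLE ρ (tensorPow τ (m * k)) ∧
      ∀ δ ∈ Set.Icc (0 : ℝ) 1, blockDepolarize δ (tensorPow τ k) m ρ ∈ A (m * k)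

/-- Axiom Q.II: closedness under tensor powers. -/
def AxiomQII {ι : Type*} (A : ∀ n : ℕ, Set (MatN ι n)) : Prop :=
  ∀ m k : ℕ, 1 ≤ m → 1 ≤ k → ∀ ρ ∈ A k, powBlocks ρ m ∈ A (m * k)

/-- Axiom Q.III: closedness under permutations of the tensor factors. -/
def AxiomQIII {ι : Type*} (A : ∀ n : ℕ, Set (MatN ι n)) : Prop :=
  ∀ n : ℕ, ∀ ρ ∈ A n, ∀ π : Equiv.Perm (Fin n), permCopies π ρ ∈ A n

/-- Axiom Q.IV: filtering by Hermitian operators in a neighbourhood of the identity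
is completely `cone(𝒜)`-preserving. -/
def AxiomQIV {ι : Type*} [Fintype ι] [DecidableEq ι] (A : ∀ n : ℕ, Set (MatN ι n)) : Prop :=
  ∀ k : ℕ, 1 ≤ k →
    ∃ V : Set (MatN ι k), V ∈ nhds (1 : MatN ι k) ∧
      ∀ F ∈ V, F.IsHermitian → ∀ n : ℕ, 1 ≤ n → ∀ ρ ∈ A (n + k),
        ∃ (lam : ℝ) (ω : MatN ι n), 0 ≤ lam ∧ ω ∈ A n ∧ condReduce ρ F = (lam : ℂ) • ω

set_option linter.unusedSectionVars false

section Spectral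
variable {κ : Type*} [Fintype κ] [DecidableEq κ]

/-- The Hermitian matrix with eigenvector matrix `U` and real eigenvalues `h`. -/
def conjDiag (U : Matrix κ κ ℂ) (h : κ → ℝ) : Matrix κ κ ℂ :=
  U * Matrix.diagonal (fun i => (h i : ℂ)) * U.conjTranspose

lemma conjDiag_isHermitian (U : Matrix κ κ ℂ) (h : κ → ℝ) : (conjDiag U h).IsHermitian := by
  unfold conjDiag Matrix.IsHermitian
  rw [Matrix.conjTranspose_mul, Matrix.conjTranspose_mul, Matrix.conjTranspose_conjTranspose,
    Matrix.diagonal_conjTranspose, Matrix.mul_assoc]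
  congr 3
  ext i
  simp

lemma conjTranspose_mul_conjDiag {U : Matrix κ κ ℂ} (hU : U.conjTranspose * U = 1) (h : κ → ℝ) :
    U.conjTranspose * conjDiag U h = Matrix.diagonal (fun i => (h i : ℂ)) * U.conjTranspose := by
  unfold conjDiag
  rw [← Matrix.mul_assoc, ← Matrix.mul_assoc, hU, Matrix.one_mul]

lemma conjDiag_mul {U : Matrix κ κ ℂ} (hU : U.conjTranspose * U = 1) (h : κ → ℝ) :
    conjDiag U h * U = U * Matrix.diagonal (fun i => (h i : ℂ)) := by
  unfold conjDiag
  rw [Matrix.mul_assoc, hU, Matrix.mul_one]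

lemma conjDiag_mul_conjDiag {U : Matrix κ κ ℂ} (hU : U.conjTranspose * U = 1) (h g : κ → ℝ) :
    conjDiag U h * conjDiag U g = conjDiag U (fun i => h i * g i) := by
  have : conjDiag U h * conjDiag U g = conjDiag U h * U *
      (Matrix.diagonal (fun i => (g i : ℂ)) * U.conjTranspose) := by
    simp only [conjDiag, Matrix.mul_assoc]
  rw [this, conjDiag_mul hU]
  unfold conjDiag
  simp only [Matrix.mul_assoc]
  rw [← Matrix.mul_assoc (Matrix.diagonal _) (Matrix.diagonal _), Matrix.diagonal_mul_diagonal]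
  simp

lemma eq_conjDiag_of_isHermitian {A : Matrix κ κ ℂ} (hA : A.IsHermitian) :
    ((hA.eigenvectorUnitary : Matrix κ κ ℂ).conjTranspose *
      (hA.eigenvectorUnitary : Matrix κ κ ℂ) = 1) ∧
    A = conjDiag (hA.eigenvectorUnitary : Matrix κ κ ℂ) hA.eigenvalues := by
  constructor
  · exact Unitary.coe_star_mul_self hA.eigenvectorUnitary
  · conv_lhs => rw [hA.spectral_theorem, Unitary.conjStarAlgAut_apply]
    rfl

/-- Two spectral decompositions of the same matrix yield the same functional calculus. -/
lemma conjDiag_comp_eq {U V : Matrix κ κ ℂ} (hU : U.conjTranspose * U = 1)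
    (hV : V.conjTranspose * V = 1) {a b : κ → ℝ} (h : conjDiag U a = conjDiag V b) (f : ℝ → ℝ) :
    conjDiag U (fun i => f (a i)) = conjDiag V (fun i => f (b i)) := by
  set W := U.conjTranspose * V with hW
  have hU' : U * U.conjTranspose = 1 := mul_eq_one_comm.mp hU
  have hV' : V * V.conjTranspose = 1 := mul_eq_one_comm.mp hV
  have h1 : Matrix.diagonal (fun i => (a i : ℂ)) * W = W * Matrix.diagonal (fun i => (b i : ℂ)) := by
    rw [hW, ← Matrix.mul_assoc, ← conjTranspose_mul_conjDiag hU, h, Matrix.mul_assoc,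
      conjDiag_mul hV, Matrix.mul_assoc]
  have h2 : Matrix.diagonal (fun i => ((f (a i) : ℝ) : ℂ)) * W =
      W * Matrix.diagonal (fun i => ((f (b i) : ℝ) : ℂ)) := by
    ext i j
    have := congrFun (congrFun h1 i) j
    rw [Matrix.diagonal_mul, Matrix.mul_diagonal] at this ⊢
    by_cases hz : W i j = 0
    · simp [hz]
    · have : (a i : ℂ) = b j := by
        rw [mul_comm] at this
        exact mul_left_cancel₀ hz this
      have : a i = b j := by exact_mod_cast this
      rw [this, mul_comm]
  calc conjDiag U (fun i => f (a i))
      = U * (Matrix.diagonal (fun i => ((f (a i) : ℝ) : ℂ)) * W) * V.conjTranspose := by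
        rw [hW]; simp only [conjDiag, Matrix.mul_assoc, hV', Matrix.mul_one]
    _ = _ := by
        rw [h2, hW]
        simp only [conjDiag, ← Matrix.mul_assoc, hU', Matrix.one_mul]

lemma matLog_conjDiag {U : Matrix κ κ ℂ} (hU : U.conjTranspose * U = 1) (h : κ → ℝ) :
    matLog (conjDiag U h) = conjDiag U (fun i => Real.log (h i)) := by
  have hH := conjDiag_isHermitian U h
  unfold matLog
  rw [dif_pos hH]
  obtain ⟨h1, h2⟩ := eq_conjDiag_of_isHermitian hH
  exact conjDiag_comp_eq h1 hU h2.symm Real.log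

lemma trace_mul_conjDiag (ρ U : Matrix κ κ ℂ) (h : κ → ℝ) :
    (ρ * conjDiag U h).trace = ∑ i, (h i : ℂ) * (U.conjTranspose * ρ * U) i i := by
  unfold conjDiag
  rw [← Matrix.mul_assoc, Matrix.trace_mul_comm, ← Matrix.mul_assoc, ← Matrix.mul_assoc,
    Matrix.trace_mul_comm]
  simp [Matrix.trace, Matrix.diagonal_mul]

lemma conj_conjDiag_apply (U V : Matrix κ κ ℂ) (h : κ → ℝ) (i : κ) :
    (U.conjTranspose * conjDiag V h * U) i i =
      ((∑ j, h j * ‖(U.conjTranspose * V) i j‖ ^ 2 : ℝ) : ℂ) := by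
  have : U.conjTranspose * conjDiag V h * U = (U.conjTranspose * V) *
      Matrix.diagonal (fun i => (h i : ℂ)) * (U.conjTranspose * V).conjTranspose := by
    unfold conjDiag
    rw [Matrix.conjTranspose_mul, Matrix.conjTranspose_conjTranspose]
    simp only [Matrix.mul_assoc]
  rw [this, Matrix.mul_apply]
  push_cast
  refine Finset.sum_congr rfl fun j _ => ?_
  rw [Matrix.mul_diagonal, Matrix.conjTranspose_apply, ← Complex.mul_conj']
  simp only [RCLike.star_def]
  ring

lemma sum_norm_sq_row {W : Matrix κ κ ℂ} (hW : W * W.conjTranspose = 1) (i : κ) :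
    ∑ j, ‖W i j‖ ^ 2 = 1 := by
  have := congrFun (congrFun hW i) i
  rw [Matrix.mul_apply, Matrix.one_apply_eq] at this
  have h2 : ((∑ j, ‖W i j‖ ^ 2 : ℝ) : ℂ) = 1 := by
    rw [← this]; push_cast
    refine Finset.sum_congr rfl fun j _ => ?_
    rw [Matrix.conjTranspose_apply, ← Complex.mul_conj']; rfl
  exact_mod_cast h2

lemma sum_norm_sq_col {W : Matrix κ κ ℂ} (hW : W.conjTranspose * W = 1) (j : κ) :
    ∑ i, ‖W i j‖ ^ 2 = 1 := by
  have := sum_norm_sq_row (W := W.conjTranspose) (by simpa using hW) j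
  simpa [Matrix.conjTranspose_apply] using this

lemma conjTranspose_mul_unitary {U V : Matrix κ κ ℂ} (hU : U.conjTranspose * U = 1)
    (hV : V.conjTranspose * V = 1) :
    (U.conjTranspose * V).conjTranspose * (U.conjTranspose * V) = 1 := by
  have hU' : U * U.conjTranspose = 1 := mul_eq_one_comm.mp hU
  rw [Matrix.conjTranspose_mul, Matrix.conjTranspose_conjTranspose, Matrix.mul_assoc,
    ← Matrix.mul_assoc U, hU', Matrix.one_mul, hV]

lemma eq_conjDiag_of_conj {U A : Matrix κ κ ℂ} (hU : U.conjTranspose * U = 1) {a : κ → ℝ}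
    (h : A * U = U * Matrix.diagonal (fun i => (a i : ℂ))) : A = conjDiag U a := by
  have hU' : U * U.conjTranspose = 1 := mul_eq_one_comm.mp hU
  rw [conjDiag, ← h, Matrix.mul_assoc, hU', Matrix.mul_one]

/-- Commuting Hermitian matrices are simultaneously diagonalisable. -/
lemma exists_joint_conjDiag {A B : Matrix κ κ ℂ} (hA : A.IsHermitian) (hB : B.IsHermitian)
    (hAB : A * B = B * A) :
    ∃ (U : Matrix κ κ ℂ) (a b : κ → ℝ), U.conjTranspose * U = 1 ∧
      A = conjDiag U a ∧ B = conjDiag U b := by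
  have hTA := Matrix.isSymmetric_toEuclideanLin_iff.mpr hA
  have hTB := Matrix.isSymmetric_toEuclideanLin_iff.mpr hB
  set TA := Matrix.toEuclideanLin A with hTAdef
  set TB := Matrix.toEuclideanLin B with hTBdef
  have hcomm : ∀ x, TA (TB x) = TB (TA x) := by
    intro x
    simp only [hTAdef, hTBdef, Matrix.toLpLin_apply, Matrix.mulVec_mulVec, hAB]
  have hinv : ∀ μ : ℂ, ∀ v ∈ Module.End.eigenspace TA μ, TB v ∈ Module.End.eigenspace TA μ := by
    intro μ v hv
    rw [Module.End.mem_eigenspace_iff] at hv ⊢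
    rw [hcomm, hv, map_smul]
  have hfam := hTA.orthogonalFamily_eigenspaces'
  have hInt := hTA.direct_sum_isInternal
  let bas := fun μ : Module.End.Eigenvalues TA =>
    (hTB.restrict_invariant (hinv (μ : ℂ))).eigenvectorBasis rfl
  let bb := hInt.collectedOrthonormalBasis hfam bas
  have hcard : Fintype.card (Σ μ : Module.End.Eigenvalues TA,
      Fin (Module.finrank ℂ (Module.End.eigenspace TA (μ : ℂ)))) = Fintype.card κ := by
    rw [← Module.finrank_eq_card_basis bb.toBasis, finrank_euclideanSpace]
  let e := Fintype.equivOfCardEq hcard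
  let b' := bb.reindex e
  have key : ∀ i, ∃ a b : ℝ, TA (b' i) = (a : ℂ) • b' i ∧ TB (b' i) = (b : ℂ) • b' i := by
    intro i
    obtain ⟨⟨μ, t⟩, rfl⟩ := e.surjective i
    have hb : b' (e ⟨μ, t⟩) = (bas μ t : EuclideanSpace ℂ κ) := by
      simp only [b', bb, OrthonormalBasis.reindex_apply, Equiv.symm_apply_apply]
      rw [DirectSum.IsInternal.collectedOrthonormalBasis, Module.Basis.coe_toOrthonormalBasis,
        DirectSum.IsInternal.collectedBasis_coe]
      simp
    rw [hb]
    have hμ : ((((μ : ℂ).re : ℝ)) : ℂ) = μ := by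
      have := hTA.conj_eigenvalue_eq_self μ.2
      exact Complex.conj_eq_iff_re.mp this
    refine ⟨(μ : ℂ).re, (hTB.restrict_invariant (hinv (μ : ℂ))).eigenvalues rfl t, ?_, ?_⟩
    · rw [hμ]
      exact Module.End.mem_eigenspace_iff.mp (bas μ t).2
    · have := (hTB.restrict_invariant (hinv (μ : ℂ))).apply_eigenvectorBasis rfl t
      exact congrArg Subtype.val this
  choose a b hab using key
  let U : Matrix κ κ ℂ := Matrix.of fun i j => b' j i
  have hU : U.conjTranspose * U = 1 := by
    ext i j
    rw [Matrix.mul_apply, Matrix.one_apply]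
    have := orthonormal_iff_ite.mp b'.orthonormal i j
    rw [← this, PiLp.inner_apply]
    refine Finset.sum_congr rfl fun k _ => ?_
    simp [U, Matrix.conjTranspose_apply, mul_comm]
  refine ⟨U, a, b, hU, eq_conjDiag_of_conj hU ?_, eq_conjDiag_of_conj hU ?_⟩
  · ext i j
    have := congrArg (fun v : EuclideanSpace ℂ κ => v i) (hab j).1
    simp only [hTAdef, Matrix.toLpLin_apply] at this
    rw [Matrix.mul_diagonal]
    simpa [Matrix.mul_apply, Matrix.mulVec, dotProduct, U, mul_comm] using this
  · ext i j
    have := congrArg (fun v : EuclideanSpace ℂ κ => v i) (hab j).2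
    simp only [hTBdef, Matrix.toLpLin_apply] at this
    rw [Matrix.mul_diagonal]
    simpa [Matrix.mul_apply, Matrix.mulVec, dotProduct, U, mul_comm] using this

end Spectral

section RelativeEntropy
variable {κ : Type*} [Fintype κ] [DecidableEq κ]

/-- Squared moduli of the overlaps of the columns of two matrices. -/
def overlap (U V : Matrix κ κ ℂ) (i j : κ) : ℝ := ‖(U.conjTranspose * V) i j‖ ^ 2

lemma overlap_nonneg (U V : Matrix κ κ ℂ) (i j : κ) : 0 ≤ overlap U V i j := by
  unfold overlap; positivity

lemma overlap_comm (U V : Matrix κ κ ℂ) (i j : κ) : overlap U V i j = overlap V U j i := by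
  unfold overlap
  have : (U.conjTranspose * V) i j = star ((V.conjTranspose * U) j i) := by
    rw [← Matrix.conjTranspose_apply, Matrix.conjTranspose_mul, Matrix.conjTranspose_conjTranspose]
  rw [this, norm_star]

lemma sum_overlap_left {U V : Matrix κ κ ℂ} (hU : U.conjTranspose * U = 1)
    (hV : V.conjTranspose * V = 1) (j : κ) : ∑ i, overlap U V i j = 1 :=
  sum_norm_sq_col (conjTranspose_mul_unitary hU hV) j

lemma sum_overlap_right {U V : Matrix κ κ ℂ} (hU : U.conjTranspose * U = 1)
    (hV : V.conjTranspose * V = 1) (i : κ) : ∑ j, overlap U V i j = 1 := by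
  simp_rw [overlap_comm U V]
  exact sum_overlap_left hV hU i

lemma trace_conjDiag {U : Matrix κ κ ℂ} (hU : U.conjTranspose * U = 1) (h : κ → ℝ) :
    (conjDiag U h).trace = ((∑ i, h i : ℝ) : ℂ) := by
  rw [conjDiag, Matrix.trace_mul_comm, ← Matrix.mul_assoc, hU, Matrix.one_mul,
    Matrix.trace_diagonal]
  push_cast; rfl

lemma diag_conj_nonneg {A : Matrix κ κ ℂ} (hA : A.PosSemidef) (U : Matrix κ κ ℂ) (i : κ) :
    0 ≤ ((U.conjTranspose * A * U) i i).re := by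
  have := (hA.conjTranspose_mul_mul_same U).diag_nonneg (i := i)
  exact (Complex.le_def.mp this).1

/-- Spectral decomposition of a positive semidefinite matrix. -/
lemma exists_conjDiag_nonneg {A : Matrix κ κ ℂ} (hA : A.PosSemidef) :
    ∃ (U : Matrix κ κ ℂ) (h : κ → ℝ), U.conjTranspose * U = 1 ∧ (∀ i, 0 ≤ h i) ∧
      A = conjDiag U h := by
  obtain ⟨h1, h2⟩ := eq_conjDiag_of_isHermitian hA.isHermitian
  exact ⟨_, _, h1, hA.eigenvalues_nonneg, h2⟩

lemma conjDiag_posSemidef (U : Matrix κ κ ℂ) {h : κ → ℝ} (hh : ∀ i, 0 ≤ h i) :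
    (conjDiag U h).PosSemidef := by
  unfold conjDiag
  refine Matrix.PosSemidef.mul_mul_conjTranspose_same ?_ U
  rw [Matrix.posSemidef_diagonal_iff]
  intro i
  exact_mod_cast hh i

lemma nonneg_of_conjDiag_posSemidef {U : Matrix κ κ ℂ} (hU : U.conjTranspose * U = 1) {h : κ → ℝ}
    (hp : (conjDiag U h).PosSemidef) (i : κ) : 0 ≤ h i := by
  have := diag_conj_nonneg hp U i
  rw [conjTranspose_mul_conjDiag hU, Matrix.mul_assoc, hU, Matrix.mul_one,
    Matrix.diagonal_apply_eq] at this
  simpa using this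

lemma trace_mul_re_nonneg {A B : Matrix κ κ ℂ} (hA : A.PosSemidef) (hB : B.PosSemidef) :
    0 ≤ (A * B).trace.re := by
  obtain ⟨U, h, hU, hh, rfl⟩ := exists_conjDiag_nonneg hB
  rw [trace_mul_conjDiag, Complex.re_sum]
  refine Finset.sum_nonneg fun i _ => ?_
  rw [Complex.re_ofReal_mul]
  exact mul_nonneg (hh i) (diag_conj_nonneg hA U i)

lemma suppLE_conjDiag_iff {U V : Matrix κ κ ℂ} (hU : U.conjTranspose * U = 1)
    (hV : V.conjTranspose * V = 1) (r s : κ → ℝ) :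
    suppLE (conjDiag U r) (conjDiag V s) ↔ ∀ i j, s j = 0 → r i * overlap U V i j = 0 := by
  have hentry : ∀ i j, (V.conjTranspose * conjDiag U r * U) j i =
      (V.conjTranspose * U) j i * r i := by
    intro i j
    rw [Matrix.mul_assoc, conjDiag_mul hU, ← Matrix.mul_assoc, Matrix.mul_diagonal]
  constructor
  · intro h i j hs
    have hrow : ∀ x, (V.conjTranspose * conjDiag U r).mulVec x j = 0 := by
      intro x
      have hx : (conjDiag U r).mulVec x ∈ LinearMap.range (Matrix.toLin' (conjDiag V s)) :=
        h ⟨x, by rw [Matrix.toLin'_apply]⟩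
      obtain ⟨y, hy⟩ := hx
      rw [Matrix.toLin'_apply] at hy
      rw [← Matrix.mulVec_mulVec, ← hy, Matrix.mulVec_mulVec, conjTranspose_mul_conjDiag hV,
        ← Matrix.mulVec_mulVec, Matrix.mulVec_diagonal, hs]
      simp
    have h0 : (V.conjTranspose * conjDiag U r * U) j i = 0 := hrow (fun k => U k i)
    rw [hentry] at h0
    rw [overlap_comm, overlap]
    rcases mul_eq_zero.mp h0 with h1 | h1
    · simp [h1]
    · have : r i = 0 := by exact_mod_cast h1
      simp [this]
  · intro h
    have hV' : V * V.conjTranspose = 1 := mul_eq_one_comm.mp hV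
    have hU' : U * U.conjTranspose = 1 := mul_eq_one_comm.mp hU
    have hz : ∀ j, s j = 0 → ∀ k, (V.conjTranspose * conjDiag U r) j k = 0 := by
      intro j hs k
      have h1 : V.conjTranspose * conjDiag U r =
          (V.conjTranspose * conjDiag U r * U) * U.conjTranspose := by
        rw [Matrix.mul_assoc _ U, hU', Matrix.mul_one]
      rw [h1, Matrix.mul_apply]
      refine Finset.sum_eq_zero fun i _ => ?_
      rw [hentry]
      have := h i j hs
      rw [overlap_comm, overlap] at this
      rcases mul_eq_zero.mp this with h2 | h2
      · simp [h2]
      · have : (V.conjTranspose * U) j i = 0 := by simpa using h2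
        simp [this]
    have hfac : conjDiag U r = conjDiag V s * (conjDiag V (fun j => (s j)⁻¹) * conjDiag U r) := by
      rw [← Matrix.mul_assoc, conjDiag_mul_conjDiag hV]
      have : V.conjTranspose * conjDiag U r =
          V.conjTranspose * (conjDiag V (fun i => s i * (s i)⁻¹) * conjDiag U r) := by
        rw [← Matrix.mul_assoc, conjTranspose_mul_conjDiag hV, Matrix.mul_assoc]
        ext j k
        rw [Matrix.diagonal_mul]
        by_cases hs : s j = 0
        · rw [hz j hs k, mul_zero]
        · rw [mul_inv_cancel₀ hs]; simp
      have h2 := congrArg (V * ·) this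
      simpa only [← Matrix.mul_assoc, hV', Matrix.one_mul] using h2
    rw [suppLE]
    rintro _ ⟨x, rfl⟩
    refine ⟨(conjDiag V (fun j => (s j)⁻¹) * conjDiag U r).mulVec x, ?_⟩
    rw [Matrix.toLin'_apply, Matrix.toLin'_apply, Matrix.mulVec_mulVec, ← hfac]

/-- The relative entropy in terms of the spectral decompositions of both arguments. -/
lemma trace_relEnt_conjDiag {U V : Matrix κ κ ℂ} (hU : U.conjTranspose * U = 1)
    (hV : V.conjTranspose * V = 1) (r s : κ → ℝ) :
    ((conjDiag U r * (matLog (conjDiag U r) - matLog (conjDiag V s))).trace.re) =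
      ∑ i, ∑ j, overlap U V i j * (r i * (Real.log (r i) - Real.log (s j))) := by
  rw [matLog_conjDiag hU, matLog_conjDiag hV, Matrix.mul_sub, Matrix.trace_sub,
    conjDiag_mul_conjDiag hU, trace_conjDiag hU, trace_mul_conjDiag]
  simp_rw [conj_conjDiag_apply]
  rw [Complex.sub_re, Complex.ofReal_re]
  have h1 : (∑ j, ((Real.log (s j) : ℝ) : ℂ) *
      ((∑ i, r i * ‖(V.conjTranspose * U) j i‖ ^ 2 : ℝ) : ℂ)).re =
      ∑ j, ∑ i, overlap U V i j * (r i * Real.log (s j)) := by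
    rw [Complex.re_sum]
    refine Finset.sum_congr rfl fun j _ => ?_
    rw [← Complex.ofReal_mul, Complex.ofReal_re, Finset.mul_sum]
    refine Finset.sum_congr rfl fun i _ => ?_
    rw [overlap_comm, overlap]; ring
  rw [h1, Finset.sum_comm, ← Finset.sum_sub_distrib]
  refine Finset.sum_congr rfl fun i _ => ?_
  simp_rw [mul_sub, Finset.sum_sub_distrib]
  rw [← Finset.sum_mul, sum_overlap_right hU hV, one_mul]

/-- Lower bound on the total error of a binary test in terms of the overlaps of the
spectral decompositions of both hypotheses. -/
lemma sum_overlap_min_le {U V : Matrix κ κ ℂ} (hU : U.conjTranspose * U = 1)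
    (hV : V.conjTranspose * V = 1) {r s : κ → ℝ} (hr : ∀ i, 0 ≤ r i)
    (hs : ∀ i, 0 ≤ s i) {t : ℝ} (ht : 0 ≤ t) {E : Matrix κ κ ℂ}
    (hE : E.PosSemidef) (hE' : (1 - E).PosSemidef) :
    (1 / 2) * ∑ i, ∑ j, overlap U V i j * min (r i) (t * s j) ≤
      (conjDiag U r * (1 - E)).trace.re + t * (conjDiag V s * E).trace.re := by
  obtain ⟨W, e, hW, he, rfl⟩ := exists_conjDiag_nonneg hE
  have hW' : W * W.conjTranspose = 1 := mul_eq_one_comm.mp hW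
  have hone : (1 : Matrix κ κ ℂ) = conjDiag W (fun _ => 1) := by
    simp [conjDiag, hW']
  have hcomp : 1 - conjDiag W e = conjDiag W (fun i => 1 - e i) := by
    rw [hone]; unfold conjDiag
    rw [← Matrix.sub_mul, ← Matrix.mul_sub, Matrix.diagonal_sub]
    simp
  have he' : ∀ i, 0 ≤ 1 - e i := nonneg_of_conjDiag_posSemidef hW (hcomp ▸ hE')
  have hpsd : ∀ (U' : Matrix κ κ ℂ) (q f : κ → ℝ), (∀ i, 0 ≤ q i) → (∀ i, 0 ≤ f i) →
      (∀ i, f i ≤ 1) →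
      (conjDiag U' q * (conjDiag W f * conjDiag W f)).trace.re ≤
        (conjDiag U' q * conjDiag W f).trace.re := by
    intro U' q f hq hf hf1
    rw [conjDiag_mul_conjDiag hW]
    have h1 : conjDiag W f = conjDiag W (fun i => f i * f i) +
        conjDiag W (fun i => f i - f i * f i) := by
      unfold conjDiag
      rw [← Matrix.add_mul, ← Matrix.mul_add, Matrix.diagonal_add]
      simp
    have h2 : 0 ≤ (conjDiag U' q * conjDiag W (fun i => f i - f i * f i)).trace.re :=
      trace_mul_re_nonneg (conjDiag_posSemidef _ hq) (conjDiag_posSemidef _ fun i => by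
        nlinarith [hf i, hf1 i])
    have h3 : (conjDiag U' q * conjDiag W f).trace.re =
        (conjDiag U' q * conjDiag W (fun i => f i * f i)).trace.re +
        (conjDiag U' q * conjDiag W (fun i => f i - f i * f i)).trace.re := by
      rw [← Complex.add_re, ← Matrix.trace_add, ← Matrix.mul_add, ← h1]
    linarith
  have hsq : ∀ (X U' V' : Matrix κ κ ℂ) (q : κ → ℝ), X.IsHermitian → V' * V'.conjTranspose = 1 →
      (conjDiag U' q * (X * X)).trace.re =
        ∑ i, ∑ j, q i * ‖(U'.conjTranspose * X * V') i j‖ ^ 2 := by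
    intro X U' V' q hX hV'
    rw [Matrix.trace_mul_comm, trace_mul_conjDiag, Complex.re_sum]
    refine Finset.sum_congr rfl fun i _ => ?_
    rw [Complex.re_ofReal_mul, ← Finset.mul_sum]
    congr 1
    have h1 : U'.conjTranspose * (X * X) * U' = (U'.conjTranspose * X * V') *
        (U'.conjTranspose * X * V').conjTranspose := by
      simp only [Matrix.conjTranspose_mul, Matrix.conjTranspose_conjTranspose, hX.eq]
      calc _ = U'.conjTranspose * X * 1 * (X * U') := by
            simp only [Matrix.mul_one, Matrix.mul_assoc]
        _ = _ := by rw [← hV']; simp only [Matrix.mul_assoc]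
    rw [h1, Matrix.mul_apply, Complex.re_sum]
    refine Finset.sum_congr rfl fun j _ => ?_
    rw [Matrix.conjTranspose_apply]
    have := Complex.mul_conj' ((U'.conjTranspose * X * V') i j)
    simp only [RCLike.star_def]
    rw [this]
    norm_cast
  have hWe := conjDiag_isHermitian W e
  have hWe' := conjDiag_isHermitian W (fun i => 1 - e i)
  have e1 := hpsd U r (fun i => 1 - e i) hr he' (fun i => by linarith [he i])
  have e2 := hpsd V s e hs he (fun i => by linarith [he' i])
  rw [hsq _ U V r hWe' (mul_eq_one_comm.mp hV)] at e1
  rw [hsq _ V U s hWe (mul_eq_one_comm.mp hU), Finset.sum_comm] at e2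
  rw [hcomp]
  refine le_trans ?_ (add_le_add e1 (mul_le_mul_of_nonneg_left e2 ht))
  rw [Finset.mul_sum, Finset.mul_sum, ← Finset.sum_add_distrib]
  refine Finset.sum_le_sum fun i _ => ?_
  rw [Finset.mul_sum, Finset.mul_sum, ← Finset.sum_add_distrib]
  refine Finset.sum_le_sum fun j _ => ?_
  have hconj : ‖(V.conjTranspose * conjDiag W e * U) j i‖ =
      ‖(U.conjTranspose * conjDiag W e * V) i j‖ := by
    have : (V.conjTranspose * conjDiag W e * U) j i =
        star ((U.conjTranspose * conjDiag W e * V) i j) := by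
      rw [← Matrix.conjTranspose_apply]
      simp only [Matrix.conjTranspose_mul, Matrix.conjTranspose_conjTranspose, hWe.eq,
        Matrix.mul_assoc]
    rw [this, norm_star]
  have hsum : (U.conjTranspose * V) i j = (U.conjTranspose * conjDiag W (fun i => 1 - e i) * V) i j +
      (U.conjTranspose * conjDiag W e * V) i j := by
    rw [← Matrix.add_apply, ← Matrix.add_mul, ← Matrix.mul_add, ← hcomp, sub_add_cancel,
      Matrix.mul_one]
  rw [hconj, overlap, hsum]
  set a := (U.conjTranspose * conjDiag W (fun i => 1 - e i) * V) i j
  set b := (U.conjTranspose * conjDiag W e * V) i j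
  have h1 : ‖a + b‖ ^ 2 ≤ 2 * ‖a‖ ^ 2 + 2 * ‖b‖ ^ 2 := by
    have := norm_add_le a b
    nlinarith [norm_nonneg (a + b), sq_nonneg (‖a‖ - ‖b‖), norm_nonneg a, norm_nonneg b]
  have hm0 : 0 ≤ min (r i) (t * s j) := le_min (hr i) (mul_nonneg ht (hs j))
  have h2 := mul_le_mul_of_nonneg_right h1 hm0
  have h3 := mul_le_mul_of_nonneg_right (min_le_left (r i) (t * s j)) (sq_nonneg ‖a‖)
  have h4 := mul_le_mul_of_nonneg_right (min_le_right (r i) (t * s j)) (sq_nonneg ‖b‖)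
  nlinarith

/-- Weak converse: a pair of states with finite relative entropy cannot be distinguished too
well. -/
lemma weak_converse {ρ σ : Matrix κ κ ℂ} (hρ : IsState ρ) (hσ : IsState σ) {x γ : ℝ}
    (hx : relEnt ρ σ ≤ (x : EReal)) (hγ : 0 < γ) {E : Matrix κ κ ℂ}
    (hE : E.PosSemidef) (hE' : (1 - E).PosSemidef) :
    γ / (2 * (1 + γ)) ≤ (ρ * (1 - E)).trace.re +
      Real.exp ((1 + γ) * (x + 1)) * (σ * E).trace.re := by
  obtain ⟨U, r, hU, hr, rfl⟩ := exists_conjDiag_nonneg hρ.1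
  obtain ⟨V, s, hV, hs, rfl⟩ := exists_conjDiag_nonneg hσ.1
  have hr1 : ∑ i, r i = 1 := by
    have := hρ.2; rw [trace_conjDiag hU] at this; exact_mod_cast this
  have hs1 : ∑ i, s i = 1 := by
    have := hσ.2; rw [trace_conjDiag hV] at this; exact_mod_cast this
  have hsupp : suppLE (conjDiag U r) (conjDiag V s) := by
    by_contra h
    rw [relEnt, if_neg h] at hx
    exact absurd (top_le_iff.mp hx) (EReal.coe_ne_top x)
  have hD := hx
  rw [relEnt, if_pos hsupp, EReal.coe_le_coe_iff, trace_relEnt_conjDiag hU hV] at hD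
  rw [suppLE_conjDiag_iff hU hV] at hsupp
  set a := overlap U V with ha
  have ha0 : ∀ i j, 0 ≤ a i j := overlap_nonneg U V
  set T := (1 + γ) * (x + 1) with hT
  have key := sum_overlap_min_le hU hV hr hs (Real.exp_pos T).le hE hE'
  refine le_trans ?_ key
  have hP1 : ∑ i, ∑ j, a i j * r i = 1 := by
    rw [← hr1]
    refine Finset.sum_congr rfl fun i _ => ?_
    rw [← Finset.sum_mul, sum_overlap_right hU hV, one_mul]
  have hQ1 : ∑ i, ∑ j, a i j * s j = 1 := by
    rw [← hs1, Finset.sum_comm]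
    refine Finset.sum_congr rfl fun i _ => ?_
    rw [← Finset.sum_mul, sum_overlap_left hU hV, one_mul]
  have hbasic : ∀ i j, a i j * r i - a i j * s j ≤
      a i j * (r i * (Real.log (r i) - Real.log (s j))) := by
    intro i j
    rcases (hr i).eq_or_lt with h | h
    · rw [← h]; have := mul_nonneg (ha0 i j) (hs j); simp; linarith
    rcases (hs j).eq_or_lt with h' | h'
    · have h0 := hsupp i j h'.symm
      have : a i j = 0 := by
        rcases mul_eq_zero.mp h0 with h1 | h1
        · exact absurd h1 h.ne'
        · exact h1
      simp [this]
    · rw [← mul_sub]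
      refine mul_le_mul_of_nonneg_left ?_ (ha0 i j)
      have h1 : Real.log (s j / r i) ≤ s j / r i - 1 := Real.log_le_sub_one_of_pos (by positivity)
      rw [Real.log_div h'.ne' h.ne'] at h1
      have h2 := mul_le_mul_of_nonneg_left h1 h.le
      have h3 : r i * (s j / r i - 1) = s j - r i := by field_simp
      rw [h3] at h2
      nlinarith
  have hx0 : 0 ≤ x := by
    refine le_trans ?_ hD
    have : ∑ i, ∑ j, (a i j * r i - a i j * s j) ≤
        ∑ i, ∑ j, a i j * (r i * (Real.log (r i) - Real.log (s j))) :=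
      Finset.sum_le_sum fun i _ => Finset.sum_le_sum fun j _ => hbasic i j
    simp_rw [Finset.sum_sub_distrib] at this
    linarith
  have hTpos : 0 < T := by positivity
  have hpt : ∀ i j, a i j * r i - a i j * min (r i) (Real.exp T * s j) ≤
      T⁻¹ * (a i j * (r i * (Real.log (r i) - Real.log (s j))) + a i j * s j) := by
    intro i j
    have hn : 0 ≤ a i j * (r i * (Real.log (r i) - Real.log (s j))) + a i j * s j := by
      have := hbasic i j
      have := mul_nonneg (ha0 i j) (hr i)
      linarith
    by_cases hg : r i ≤ Real.exp T * s j
    · rw [min_eq_left hg, sub_self]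
      exact mul_nonneg (inv_nonneg.mpr hTpos.le) hn
    · push Not at hg
      have hr' : 0 < r i := lt_of_le_of_lt (mul_nonneg (Real.exp_pos T).le (hs j)) hg
      rcases (hs j).eq_or_lt with h' | h'
      · have h0 := hsupp i j h'.symm
        have : a i j = 0 := by
          rcases mul_eq_zero.mp h0 with h1 | h1
          · exact absurd h1 hr'.ne'
          · exact h1
        simp [this]
      · have hl : T ≤ Real.log (r i) - Real.log (s j) := by
          have := Real.log_le_log (by positivity) hg.le
          rw [Real.log_mul (Real.exp_pos T).ne' h'.ne', Real.log_exp] at this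
          linarith
        have h1 : a i j * r i ≤ T⁻¹ * (a i j * (r i * (Real.log (r i) - Real.log (s j)))) := by
          rw [inv_mul_eq_div, le_div_iff₀ hTpos]
          have := mul_le_mul_of_nonneg_left hl (mul_nonneg (ha0 i j) (hr i))
          linarith
        have h2 : 0 ≤ a i j * min (r i) (Real.exp T * s j) :=
          mul_nonneg (ha0 i j) (le_min (hr i) (mul_nonneg (Real.exp_pos T).le (hs j)))
        have h3 : 0 ≤ T⁻¹ * (a i j * s j) :=
          mul_nonneg (inv_nonneg.mpr hTpos.le) (mul_nonneg (ha0 i j) (hs j))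
        rw [mul_add]; linarith
  have hsum : ∑ i, ∑ j, (a i j * r i - a i j * min (r i) (Real.exp T * s j)) ≤
      ∑ i, ∑ j, T⁻¹ * (a i j * (r i * (Real.log (r i) - Real.log (s j))) + a i j * s j) :=
    Finset.sum_le_sum fun i _ => Finset.sum_le_sum fun j _ => hpt i j
  simp_rw [Finset.sum_sub_distrib, ← Finset.mul_sum, Finset.sum_add_distrib] at hsum
  rw [hP1, hQ1] at hsum
  have hfin : T⁻¹ * (∑ i, ∑ j, a i j * (r i * (Real.log (r i) - Real.log (s j))) + 1) ≤
      1 / (1 + γ) := by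
    rw [inv_mul_eq_div, hT, div_le_div_iff₀ hTpos (by positivity)]
    nlinarith
  have h5 : 1 - 1 / (1 + γ) = 2 * (γ / (2 * (1 + γ))) := by field_simp; ring
  linarith

end RelativeEntropy

section Score
variable {κ : Type*} [Fintype κ] [DecidableEq κ]

lemma sum_norm_sq_sum_le {α β : Type*} [Fintype β] (s : Finset α) (f : α → β → ℂ) :
    ∑ b, ‖∑ a ∈ s, f a b‖ ^ 2 ≤ s.card * ∑ a ∈ s, ∑ b, ‖f a b‖ ^ 2 := by
  rw [Finset.sum_comm, Finset.mul_sum]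
  refine Finset.sum_le_sum fun b _ => ?_
  calc ‖∑ a ∈ s, f a b‖ ^ 2 ≤ (∑ a ∈ s, ‖f a b‖) ^ 2 := by
        gcongr; exact norm_sum_le _ _
    _ ≤ _ := sq_sum_le_card_mul_sum_sq

lemma posSemidef_quadratic_eq {R B : Matrix κ κ ℂ} (hB : R = B.conjTranspose * B) (y : κ → ℂ) :
    (∑ i, ∑ j, star (y i) * R i j * y j) = ((∑ b, ‖∑ j, B b j * y j‖ ^ 2 : ℝ) : ℂ) := by
  subst hB
  push_cast
  simp_rw [← Complex.conj_mul', Matrix.mul_apply, Matrix.conjTranspose_apply, map_sum, map_mul,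
    Finset.sum_mul_sum, Finset.mul_sum, Finset.sum_mul]
  rw [Finset.sum_comm' (t' := Finset.univ) (s' := fun _ => Finset.univ) (by simp)]
  conv_lhs =>
    enter [2, j]
    rw [Finset.sum_comm]
  rw [Finset.sum_comm]
  refine Finset.sum_congr rfl fun b _ => ?_
  rw [Finset.sum_comm]
  refine Finset.sum_congr rfl fun i _ => ?_
  refine Finset.sum_congr rfl fun j _ => ?_
  simp only [RCLike.star_def]
  ring

/-- The pinching inequality. -/
lemma pinching_inequality {R : Matrix κ κ ℂ} (hR : R.PosSemidef) (w : κ → ℝ) (y : κ → ℂ) :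
    (∑ i, ∑ j, star (y i) * R i j * y j).re ≤ (Finset.univ.image w).card *
      (∑ i, ∑ j, star (y i) * (if w i = w j then R i j else 0) * y j).re := by
  obtain ⟨B, hB⟩ : ∃ B : Matrix κ κ ℂ, R = B.conjTranspose * B := by
    obtain ⟨U, h, -, hh, rfl⟩ := exists_conjDiag_nonneg hR
    refine ⟨Matrix.diagonal (fun i => (Real.sqrt (h i) : ℂ)) * U.conjTranspose, ?_⟩
    rw [Matrix.conjTranspose_mul, Matrix.conjTranspose_conjTranspose, Matrix.diagonal_conjTranspose,
      Matrix.mul_assoc, ← Matrix.mul_assoc (Matrix.diagonal _), Matrix.diagonal_mul_diagonal,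
      ← Matrix.mul_assoc, conjDiag]
    congr 3
    ext i
    simp only [Pi.star_apply, RCLike.star_def, Complex.conj_ofReal]
    rw [← Complex.ofReal_mul, Real.mul_self_sqrt (hh i)]
  set Y : ℝ → κ → ℂ := fun l j => if w j = l then y j else 0 with hY
  have h1 : ∀ b, ∑ j, B b j * y j = ∑ l ∈ Finset.univ.image w, ∑ j, B b j * Y l j := by
    intro b
    rw [Finset.sum_comm]
    refine Finset.sum_congr rfl fun j _ => ?_
    rw [← Finset.mul_sum, Finset.sum_ite_eq, if_pos (by simp)]
  have h2 : (∑ i, ∑ j, star (y i) * (if w i = w j then R i j else 0) * y j) =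
      ∑ l ∈ Finset.univ.image w, ∑ i, ∑ j, star (Y l i) * R i j * Y l j := by
    symm
    rw [Finset.sum_comm]
    refine Finset.sum_congr rfl fun i _ => ?_
    rw [Finset.sum_comm]
    refine Finset.sum_congr rfl fun j _ => ?_
    rw [Finset.sum_eq_single (w i)]
    · simp only [hY, if_true]
      by_cases h : w i = w j
      · simp [h]
      · simp [h, Ne.symm h]
    · intro l _ hl
      simp [hY, Ne.symm hl]
    · intro h; simp at h
  rw [h2, posSemidef_quadratic_eq hB]
  simp_rw [posSemidef_quadratic_eq hB]
  rw [Complex.ofReal_re, ← Complex.ofReal_sum, Complex.ofReal_re]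
  simp_rw [h1]
  exact sum_norm_sq_sum_le _ _

lemma conj_quadratic (V R : Matrix κ κ ℂ) (y : κ → ℂ) :
    (∑ i, ∑ j, star (y i) * (V.conjTranspose * R * V) i j * y j) =
      ∑ i, ∑ j, star (V.mulVec y i) * R i j * V.mulVec y j := by
  have h : ∀ (M : Matrix κ κ ℂ) (z : κ → ℂ),
      (∑ i, ∑ j, star (z i) * M i j * z j) = dotProduct (star z) (M.mulVec z) := by
    intro M z
    simp only [dotProduct, Matrix.mulVec, Finset.mul_sum, Pi.star_apply, mul_assoc]
  rw [h, h, Matrix.star_mulVec, ← Matrix.dotProduct_mulVec, Matrix.mulVec_mulVec,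
    Matrix.mulVec_mulVec]

/-- For each positive semidefinite `ρ`, the matrix `ω` has an eigenbasis in which the diagonal of
`ρ` dominates `ρ` up to the number of distinct eigenvalues of `ω`. -/
lemma exists_pinching_basis {ρ U0 : Matrix κ κ ℂ} (hρ : ρ.PosSemidef)
    (hU0 : U0.conjTranspose * U0 = 1) (w0 : κ → ℝ) :
    ∃ (U : Matrix κ κ ℂ) (w : κ → ℝ), U.conjTranspose * U = 1 ∧ conjDiag U0 w0 = conjDiag U w ∧
      ∀ y : κ → ℂ, (∑ i, ∑ j, star (y i) * (U.conjTranspose * ρ * U) i j * y j).re ≤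
        (Finset.univ.image w0).card *
          ∑ i, ((U.conjTranspose * ρ * U) i i).re * ‖y i‖ ^ 2 := by
  set R := U0.conjTranspose * ρ * U0 with hRdef
  have hR : R.PosSemidef := hρ.conjTranspose_mul_mul_same U0
  set R' : Matrix κ κ ℂ := Matrix.of fun i j => if w0 i = w0 j then R i j else 0 with hR'
  have hR'H : R'.IsHermitian := by
    ext i j
    rw [Matrix.conjTranspose_apply, hR', Matrix.of_apply, Matrix.of_apply]
    by_cases h : w0 i = w0 j
    · rw [if_pos h, if_pos h.symm, ← Matrix.conjTranspose_apply, hR.isHermitian.eq]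
    · rw [if_neg h, if_neg (Ne.symm h), star_zero]
  set D : Matrix κ κ ℂ := Matrix.diagonal (fun i => (w0 i : ℂ)) with hD
  have hDH : D.IsHermitian := by
    rw [hD, Matrix.IsHermitian, Matrix.diagonal_conjTranspose]
    congr 1; ext i; simp
  have hcomm : R' * D = D * R' := by
    ext i j
    rw [hD, Matrix.mul_diagonal, Matrix.diagonal_mul, hR', Matrix.of_apply]
    by_cases h : w0 i = w0 j
    · rw [h, mul_comm]
    · simp [h]
  obtain ⟨V, p, w, hV, hp, hw⟩ := exists_joint_conjDiag hR'H hDH hcomm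
  have hVw : ∀ i j, V i j ≠ 0 → w0 i = w j := by
    intro i j hz
    have h1 : D * V = V * Matrix.diagonal (fun i => (w i : ℂ)) := by rw [hw, conjDiag_mul hV]
    have h2 := congrFun (congrFun h1 i) j
    rw [hD, Matrix.diagonal_mul, Matrix.mul_diagonal, mul_comm] at h2
    exact_mod_cast mul_left_cancel₀ hz h2
  have hconj : (U0 * V).conjTranspose * ρ * (U0 * V) = V.conjTranspose * R * V := by
    rw [hRdef, Matrix.conjTranspose_mul]; simp only [Matrix.mul_assoc]
  have hdiag : ∀ j, (V.conjTranspose * R * V) j j = (p j : ℂ) := by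
    intro j
    have h1 : (V.conjTranspose * R' * V) j j = (p j : ℂ) := by
      rw [hp, conjTranspose_mul_conjDiag hV, Matrix.mul_assoc, hV, Matrix.mul_one,
        Matrix.diagonal_apply_eq]
    rw [← h1, Matrix.mul_apply, Matrix.mul_apply]
    refine Finset.sum_congr rfl fun k _ => ?_
    by_cases hk : V k j = 0
    · simp [hk]
    congr 1
    rw [Matrix.mul_apply, Matrix.mul_apply]
    refine Finset.sum_congr rfl fun i _ => ?_
    by_cases hi : V i j = 0
    · simp [hi]
    · rw [hR', Matrix.of_apply, if_pos ((hVw i j hi).trans (hVw k j hk).symm)]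
  refine ⟨U0 * V, w, ?_, ?_, ?_⟩
  · rw [Matrix.conjTranspose_mul, Matrix.mul_assoc, ← Matrix.mul_assoc _ U0, hU0, Matrix.one_mul, hV]
  · have : conjDiag U0 w0 = U0 * D * U0.conjTranspose := rfl
    rw [this, hw]; simp only [conjDiag, Matrix.conjTranspose_mul, Matrix.mul_assoc]
  · intro y
    rw [hconj]
    have h1 := pinching_inequality hR w0 (V.mulVec y)
    have h2 := conj_quadratic V R' y
    simp only [hR', Matrix.of_apply] at h2
    rw [conj_quadratic V R y]
    refine h1.trans (le_of_eq ?_)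
    rw [← h2, ← hR', hp, conjTranspose_mul_conjDiag hV, Matrix.mul_assoc, hV, Matrix.mul_one]
    congr 1
    rw [Complex.re_sum]
    refine Finset.sum_congr rfl fun i _ => ?_
    rw [Finset.sum_eq_single i]
    · rw [Matrix.diagonal_apply_eq, hdiag, Complex.ofReal_re]
      have : star (y i) * (p i : ℂ) * y i = ((p i * ‖y i‖ ^ 2 : ℝ) : ℂ) := by
        push_cast
        rw [← Complex.conj_mul']
        simp only [RCLike.star_def]; ring
      rw [this, Complex.ofReal_re]
    · intro j _ hj
      rw [Matrix.diagonal_apply_ne _ (Ne.symm hj)]; simp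
    · simp

/-- The diagonal of a state in a pinching basis has almost as little entropy as the state. -/
lemma sum_mul_log_le_of_pinching {F U : Matrix κ κ ℂ} (hF : F.conjTranspose * F = 1)
    (hU : U.conjTranspose * U = 1) {r : κ → ℝ} (hr : ∀ k, 0 ≤ r k) (hr1 : ∑ k, r k = 1)
    {v : ℕ} (hv : 1 ≤ v)
    (hpin : ∀ y : κ → ℂ,
      (∑ i, ∑ j, star (y i) * (U.conjTranspose * conjDiag F r * U) i j * y j).re ≤
        v * ∑ i, ((U.conjTranspose * conjDiag F r * U) i i).re * ‖y i‖ ^ 2) :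
    ∑ k, r k * Real.log (r k) ≤
      ∑ i, ((U.conjTranspose * conjDiag F r * U) i i).re *
        Real.log ((U.conjTranspose * conjDiag F r * U) i i).re + Real.log v := by
  set p : κ → ℝ := fun i => ((U.conjTranspose * conjDiag F r * U) i i).re with hp
  have hp' : ∀ i, p i = ∑ k, r k * overlap U F i k := by
    intro i
    rw [hp]; simp only [conj_conjDiag_apply, Complex.ofReal_re, overlap]
  have hp0 : ∀ i, 0 ≤ p i := fun i => by
    rw [hp']; exact Finset.sum_nonneg fun k _ => mul_nonneg (hr k) (overlap_nonneg _ _ _ _)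
  have hvpos : (0 : ℝ) < v := by exact_mod_cast hv
  set W := U.conjTranspose * F with hW
  have hquad : ∀ y : κ → ℂ,
      (∑ i, ∑ j, star (y i) * (U.conjTranspose * conjDiag F r * U) i j * y j).re =
        ∑ k, r k * ‖∑ i, star (W i k) * y i‖ ^ 2 := by
    intro y
    have h1 : U.conjTranspose * conjDiag F r * U =
        W.conjTranspose.conjTranspose * Matrix.diagonal (fun i => (r i : ℂ)) * W.conjTranspose := by
      rw [hW, Matrix.conjTranspose_conjTranspose, Matrix.conjTranspose_mul,
        Matrix.conjTranspose_conjTranspose, conjDiag]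
      simp only [Matrix.mul_assoc]
    rw [h1, conj_quadratic, Complex.re_sum]
    refine Finset.sum_congr rfl fun k _ => ?_
    rw [Finset.sum_eq_single k]
    · rw [Matrix.diagonal_apply_eq]
      have : ∀ z : ℂ, star z * (r k : ℂ) * z = ((r k * ‖z‖ ^ 2 : ℝ) : ℂ) := by
        intro z
        push_cast
        rw [← Complex.conj_mul']
        simp only [RCLike.star_def]; ring
      rw [this, Complex.ofReal_re]
      simp [Matrix.mulVec, dotProduct, Matrix.conjTranspose_apply]
    · intro j _ hj
      rw [Matrix.diagonal_apply_ne _ (Ne.symm hj)]; simp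
    · simp
  have hs : ∀ k, r k * ∑ i, overlap U F i k / p i ≤ v := by
    intro k
    set S := ∑ i, overlap U F i k / p i with hS
    have hS0 : 0 ≤ S := Finset.sum_nonneg fun i _ => div_nonneg (overlap_nonneg _ _ _ _) (hp0 i)
    have h1 := hpin (fun i => W i k / p i)
    rw [hquad] at h1
    have h2 : ∑ i, p i * ‖W i k / (p i : ℂ)‖ ^ 2 = S := by
      rw [hS]
      refine Finset.sum_congr rfl fun i _ => ?_
      rw [norm_div, div_pow, Complex.norm_real, Real.norm_of_nonneg (hp0 i), overlap]
      rcases (hp0 i).eq_or_lt with h | h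
      · rw [← h]; simp
      · field_simp
        rfl
    have h3 : r k * S ^ 2 ≤ ∑ l, r l * ‖∑ i, star (W i l) * (W i k / (p i : ℂ))‖ ^ 2 := by
      have h4 : ‖∑ i, star (W i k) * (W i k / (p i : ℂ))‖ = S := by
        have : ∑ i, star (W i k) * (W i k / (p i : ℂ)) = (S : ℂ) := by
          rw [hS]; push_cast
          refine Finset.sum_congr rfl fun i _ => ?_
          rw [overlap, ← mul_div_assoc]
          push_cast
          rw [← Complex.conj_mul']; rfl
        rw [this, Complex.norm_real, Real.norm_of_nonneg hS0]
      rw [← h4]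
      exact Finset.single_le_sum (f := fun l => r l * ‖∑ i, star (W i l) * (W i k / (p i : ℂ))‖ ^ 2)
        (fun l _ => mul_nonneg (hr l) (by positivity)) (Finset.mem_univ k)
    have h5 : r k * S ^ 2 ≤ v * S := by
      refine h3.trans (h1.trans (le_of_eq ?_))
      rw [← h2]
    rcases hS0.eq_or_lt with h | h
    · rw [← h]; simp
    · nlinarith
  have hpt : ∀ k i, r k * overlap U F i k * (Real.log (r k) - Real.log (p i)) ≤
      r k * overlap U F i k * (Real.log v - 1) + r k / v * (r k * (overlap U F i k / p i)) := by
    intro k i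
    rcases (hr k).eq_or_lt with h | h
    · rw [← h]; simp
    rcases (overlap_nonneg U F i k).eq_or_lt with h' | h'
    · rw [← h']; simp
    have hpi : 0 < p i := by
      rw [hp']
      exact lt_of_lt_of_le (mul_pos h h') (Finset.single_le_sum
        (f := fun k => r k * overlap U F i k)
        (fun l _ => mul_nonneg (hr l) (overlap_nonneg _ _ _ _)) (Finset.mem_univ k))
    have h1 : Real.log (r k / p i / v) ≤ r k / p i / v - 1 :=
      Real.log_le_sub_one_of_pos (by positivity)
    rw [Real.log_div (by positivity) hvpos.ne', Real.log_div h.ne' hpi.ne'] at h1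
    have h2 := mul_le_mul_of_nonneg_left h1 (mul_pos h h').le
    have h3 : r k / v * (r k * (overlap U F i k / p i)) =
        r k * overlap U F i k * (r k / p i / v) := by field_simp
    rw [h3]; linarith
  have hsum := Finset.sum_le_sum fun k (_ : k ∈ Finset.univ) =>
    Finset.sum_le_sum fun i (_ : i ∈ Finset.univ) => hpt k i
  have hL : ∑ k, ∑ i, r k * overlap U F i k * (Real.log (r k) - Real.log (p i)) =
      ∑ k, r k * Real.log (r k) - ∑ i, p i * Real.log (p i) := by
    simp_rw [mul_sub, Finset.sum_sub_distrib]
    congr 1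
    · refine Finset.sum_congr rfl fun k _ => ?_
      rw [← Finset.sum_mul, ← Finset.mul_sum, sum_overlap_left hU hF, mul_one]
    · rw [Finset.sum_comm]
      refine Finset.sum_congr rfl fun i _ => ?_
      rw [← Finset.sum_mul, hp']
  have hR : ∑ k, ∑ i, (r k * overlap U F i k * (Real.log v - 1) +
      r k / v * (r k * (overlap U F i k / p i))) ≤ Real.log v := by
    have h1 : ∀ k, ∑ i, (r k * overlap U F i k * (Real.log v - 1) +
      r k / v * (r k * (overlap U F i k / p i))) ≤ r k * Real.log v := by
      intro k
      rw [Finset.sum_add_distrib, ← Finset.sum_mul, ← Finset.mul_sum, sum_overlap_left hU hF,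
        ← Finset.mul_sum, ← Finset.mul_sum]
      have := mul_le_mul_of_nonneg_left (hs k) (div_nonneg (hr k) hvpos.le)
      rw [div_mul_cancel₀ _ hvpos.ne'] at this
      linarith
    refine (Finset.sum_le_sum fun k _ => h1 k).trans ?_
    rw [← Finset.sum_mul, hr1, one_mul]
  rw [hL] at hsum
  linarith

/-- Exponential score operators for `ω`: Hermitian `H` commuting with `ω` and satisfying
`Tr[ω exp H] ≤ 1`. -/
def IsScore (ω H : Matrix κ κ ℂ) : Prop :=
  ∃ (U : Matrix κ κ ℂ) (h w : κ → ℝ), U.conjTranspose * U = 1 ∧ H = conjDiag U h ∧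
    ω = conjDiag U w ∧ ∑ i, w i * Real.exp (h i) ≤ 1

lemma exists_isScore_gt {ρ U0 : Matrix κ κ ℂ} (hρ : IsState ρ) (hU0 : U0.conjTranspose * U0 = 1)
    (w0 : κ → ℝ) (hω : IsState (conjDiag U0 w0)) {v : ℕ} (hv : (Finset.univ.image w0).card = v)
    {c : ℝ} (hc : (c : EReal) < relEnt ρ (conjDiag U0 w0)) :
    ∃ H, IsScore (conjDiag U0 w0) H ∧ c - Real.log v < (ρ * H).trace.re := by
  obtain ⟨F, r, hF, hr, hρF⟩ := exists_conjDiag_nonneg hρ.1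
  obtain ⟨U, w, hU, hUw, hpin⟩ := exists_pinching_basis hρ.1 hU0 w0
  rw [hUw] at hω hc ⊢
  have hr1 : ∑ i, r i = 1 := by
    have := hρ.2; rw [hρF, trace_conjDiag hF] at this; exact_mod_cast this
  have hw : ∀ i, 0 ≤ w i := nonneg_of_conjDiag_posSemidef hU hω.1
  have hw1 : ∑ i, w i = 1 := by
    have := hω.2; rw [trace_conjDiag hU] at this; exact_mod_cast this
  have hv1 : 1 ≤ v := by
    rw [← hv, Nat.one_le_iff_ne_zero, Ne, Finset.card_eq_zero, Finset.image_eq_empty]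
    intro h
    rw [h] at hr1; simp at hr1
  rw [hv] at hpin
  have hent := sum_mul_log_le_of_pinching hF hU hr hr1 hv1 (hρF ▸ hpin)
  rw [← hρF] at hent
  set p : κ → ℝ := fun i => ((U.conjTranspose * ρ * U) i i).re with hp
  have hp0 : ∀ i, 0 ≤ p i := diag_conj_nonneg hρ.1 U
  have hpo : ∀ i, p i = ∑ k, r k * overlap U F i k := by
    intro i
    rw [hp]; simp only [hρF, conj_conjDiag_apply, Complex.ofReal_re, overlap]
  have hp1 : ∑ i, p i = 1 := by
    simp_rw [hpo]
    rw [Finset.sum_comm, ← hr1]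
    refine Finset.sum_congr rfl fun k _ => ?_
    rw [← Finset.mul_sum, sum_overlap_left hU hF, mul_one]
  have htr : ∀ h : κ → ℝ, (ρ * conjDiag U h).trace.re = ∑ i, h i * p i := by
    intro h
    rw [trace_mul_conjDiag, Complex.re_sum]
    exact Finset.sum_congr rfl fun i _ => by rw [Complex.re_ofReal_mul]
  set P := ∑ i, (if w i = 0 then 0 else p i * (Real.log (p i) - Real.log (w i))) with hPdef
  have hscore : ∀ s M : ℝ, 0 < s → s < 1 → ∃ H, IsScore (conjDiag U w) H ∧
      Real.log (1 - s) + P + M * ∑ i, (if w i = 0 then p i else 0) ≤ (ρ * H).trace.re := by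
    intro s M hs hs1
    refine ⟨conjDiag U (fun i => if w i = 0 then M else Real.log ((1 - s) * p i / w i + s)),
      ⟨U, _, w, hU, rfl, rfl, ?_⟩, ?_⟩
    · calc _ ≤ ∑ i, ((1 - s) * p i + s * w i) := by
            refine Finset.sum_le_sum fun i _ => ?_
            by_cases h : w i = 0
            · simp only [h, zero_mul, mul_zero, add_zero]
              exact mul_nonneg (by linarith) (hp0 i)
            · have hwi : 0 < w i := lt_of_le_of_ne (hw i) (Ne.symm h)
              rw [if_neg h, Real.exp_log]
              · field_simp; rfl
              · have := mul_nonneg (sub_nonneg.mpr hs1.le) (hp0 i)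
                positivity
        _ = 1 := by
            rw [Finset.sum_add_distrib, ← Finset.mul_sum, ← Finset.mul_sum, hp1, hw1]; ring
    · rw [htr]
      have hlog : Real.log (1 - s) ≤ 0 := Real.log_nonpos (by linarith) (by linarith)
      have hl : Real.log (1 - s) = ∑ i, Real.log (1 - s) * p i := by
        rw [← Finset.mul_sum, hp1, mul_one]
      rw [hl, hPdef, Finset.mul_sum, ← Finset.sum_add_distrib, ← Finset.sum_add_distrib]
      refine Finset.sum_le_sum fun i _ => ?_
      by_cases h : w i = 0
      · simp only [h, if_true]
        have := mul_nonpos_of_nonpos_of_nonneg hlog (hp0 i)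
        linarith
      · simp only [h, if_false]
        have hwi : 0 < w i := lt_of_le_of_ne (hw i) (Ne.symm h)
        rcases (hp0 i).eq_or_lt with h0 | h0
        · rw [← h0]; simp
        · have h1 : Real.log ((1 - s) * p i / w i) ≤ Real.log ((1 - s) * p i / w i + s) :=
            Real.log_le_log (by have : 0 < 1 - s := by linarith
                                positivity) (by linarith)
          rw [Real.log_div (mul_pos (by linarith) h0).ne' hwi.ne',
            Real.log_mul (by linarith) h0.ne'] at h1
          nlinarith
  by_cases hsupp : ∀ i, w i = 0 → p i = 0
  · have hsuppLE : suppLE ρ (conjDiag U w) := by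
      rw [hρF, suppLE_conjDiag_iff hF hU]
      intro k i hi
      have h1 := hsupp i hi
      rw [hpo] at h1
      have h2 := (Finset.sum_eq_zero_iff_of_nonneg
        (fun k _ => mul_nonneg (hr k) (overlap_nonneg U F i k))).mp h1 k (Finset.mem_univ k)
      rw [overlap_comm]; exact h2
    have hval : (ρ * (matLog ρ - matLog (conjDiag U w))).trace.re =
        ∑ k, r k * Real.log (r k) - ∑ i, Real.log (w i) * p i := by
      rw [matLog_conjDiag hU, Matrix.mul_sub, Matrix.trace_sub, Complex.sub_re, htr]
      congr 1
      conv_lhs => rw [hρF]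
      rw [matLog_conjDiag hF, conjDiag_mul_conjDiag hF, trace_conjDiag hF, Complex.ofReal_re]
    rw [relEnt, if_pos hsuppLE, EReal.coe_lt_coe_iff, hval] at hc
    have hPeq : P = ∑ i, p i * Real.log (p i) - ∑ i, Real.log (w i) * p i := by
      rw [hPdef, ← Finset.sum_sub_distrib]
      refine Finset.sum_congr rfl fun i _ => ?_
      by_cases h : w i = 0
      · rw [if_pos h, hsupp i h]; simp
      · rw [if_neg h]; ring
    have hlt : c - Real.log v < P := by rw [hPeq]; linarith
    set δ := P - (c - Real.log v) with hδ
    have hδ0 : 0 < δ := by linarith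
    obtain ⟨H, hH, hle⟩ := hscore (1 - Real.exp (-(δ / 2))) 0
      (by have := Real.exp_lt_one_iff.mpr (show -(δ / 2) < 0 by linarith); linarith)
      (by have := Real.exp_pos (-(δ / 2)); linarith)
    refine ⟨H, hH, lt_of_lt_of_le ?_ hle⟩
    rw [sub_sub_cancel, Real.log_exp]; linarith
  · push Not at hsupp
    obtain ⟨i, hi, hpi⟩ := hsupp
    set Z := ∑ i, (if w i = 0 then p i else 0) with hZ
    have hZ0 : 0 < Z := by
      refine Finset.sum_pos' (fun i _ => ?_) ⟨i, Finset.mem_univ i, ?_⟩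
      · split_ifs
        · exact hp0 i
        · exact le_rfl
      · rw [if_pos hi]; exact lt_of_le_of_ne (hp0 i) (Ne.symm hpi)
    obtain ⟨H, hH, hle⟩ := hscore (1 / 2)
      ((c - Real.log v - Real.log (1 - 1 / 2) - P + 1) / Z) (by norm_num) (by norm_num)
    refine ⟨H, hH, lt_of_lt_of_le ?_ hle⟩
    rw [div_mul_cancel₀ _ hZ0.ne']; linarith

end Score

section Minimax
variable {κ : Type*} [Fintype κ] [DecidableEq κ]

lemma mul_overlap_eq_of_conjDiag_eq {U V : Matrix κ κ ℂ} (hU : U.conjTranspose * U = 1)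
    (hV : V.conjTranspose * V = 1) {a b : κ → ℝ} (h : conjDiag U a = conjDiag V b) (i j : κ) :
    a i * overlap U V i j = b j * overlap U V i j := by
  have h1 : Matrix.diagonal (fun i => (a i : ℂ)) * (U.conjTranspose * V) =
      (U.conjTranspose * V) * Matrix.diagonal (fun i => (b i : ℂ)) := by
    rw [← Matrix.mul_assoc, ← conjTranspose_mul_conjDiag hU, h, Matrix.mul_assoc,
      conjDiag_mul hV, Matrix.mul_assoc]
  have h2 := congrFun (congrFun h1 i) j
  rw [Matrix.diagonal_mul, Matrix.mul_diagonal] at h2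
  by_cases hz : (U.conjTranspose * V) i j = 0
  · simp [overlap, hz]
  · rw [mul_comm] at h2
    have : a i = b j := by exact_mod_cast mul_left_cancel₀ hz h2
    rw [this]

lemma convex_isScore {ω : Matrix κ κ ℂ} (hω : ω.PosSemidef) : Convex ℝ {H | IsScore ω H} := by
  rintro _ ⟨U₁, h₁, w₁, hU₁, rfl, hω₁, hs₁⟩ _ ⟨U₂, h₂, w₂, hU₂, rfl, hω₂, hs₂⟩ s t hs ht hst
  have hcomm₁ : conjDiag U₁ h₁ * ω = ω * conjDiag U₁ h₁ := by
    rw [hω₁, conjDiag_mul_conjDiag hU₁, conjDiag_mul_conjDiag hU₁]; simp only [mul_comm]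
  have hcomm₂ : conjDiag U₂ h₂ * ω = ω * conjDiag U₂ h₂ := by
    rw [hω₂, conjDiag_mul_conjDiag hU₂, conjDiag_mul_conjDiag hU₂]; simp only [mul_comm]
  have hH : (s • conjDiag U₁ h₁ + t • conjDiag U₂ h₂).IsHermitian := by
    unfold Matrix.IsHermitian
    rw [Matrix.conjTranspose_add, Matrix.conjTranspose_smul, Matrix.conjTranspose_smul,
      (conjDiag_isHermitian U₁ h₁).eq, (conjDiag_isHermitian U₂ h₂).eq]
    simp
  obtain ⟨U, h, w, hU, hHU, hωU⟩ := exists_joint_conjDiag hH hω.isHermitian (by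
    rw [Matrix.add_mul, Matrix.mul_add, Matrix.smul_mul, Matrix.smul_mul, Matrix.mul_smul,
      Matrix.mul_smul, hcomm₁, hcomm₂])
  refine ⟨U, h, w, hU, hHU, hωU, ?_⟩
  have hw : ∀ i, 0 ≤ w i := nonneg_of_conjDiag_posSemidef hU (hωU ▸ hω)
  have hh : ∀ i, h i = s * (∑ j, overlap U U₁ i j * h₁ j) + t * ∑ j, overlap U U₂ i j * h₂ j := by
    intro i
    have h1 : ((U.conjTranspose * conjDiag U h * U) i i) = (h i : ℂ) := by
      rw [conjTranspose_mul_conjDiag hU, Matrix.mul_assoc, hU, Matrix.mul_one,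
        Matrix.diagonal_apply_eq]
    rw [← hHU, Matrix.mul_add, Matrix.add_mul, Matrix.mul_smul, Matrix.smul_mul, Matrix.mul_smul,
      Matrix.smul_mul, Matrix.add_apply, Matrix.smul_apply, Matrix.smul_apply, conj_conjDiag_apply,
      conj_conjDiag_apply] at h1
    have h2 := congrArg Complex.re h1
    simp only [Complex.add_re, Complex.smul_re, Complex.ofReal_re, smul_eq_mul] at h2
    rw [← h2]
    simp only [overlap, mul_comm]
  have hj : ∀ (V : Matrix κ κ ℂ) (g : κ → ℝ), V.conjTranspose * V = 1 → ∀ i,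
      Real.exp (∑ j, overlap U V i j * g j) ≤ ∑ j, overlap U V i j * Real.exp (g j) := by
    intro V g hV i
    have := convexOn_exp.map_sum_le (t := Finset.univ) (w := fun j => overlap U V i j) (p := g)
      (fun j _ => overlap_nonneg _ _ _ _) (sum_overlap_right hU hV i) (fun _ _ => Set.mem_univ _)
    simpa [smul_eq_mul] using this
  have hsum : ∀ (V : Matrix κ κ ℂ) (g v : κ → ℝ), V.conjTranspose * V = 1 → ω = conjDiag V v →
      ∑ i, w i * ∑ j, overlap U V i j * Real.exp (g j) = ∑ j, v j * Real.exp (g j) := by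
    intro V g v hV hv
    simp_rw [Finset.mul_sum]
    rw [Finset.sum_comm]
    refine Finset.sum_congr rfl fun j _ => ?_
    simp_rw [← mul_assoc, mul_overlap_eq_of_conjDiag_eq hU hV (hωU.symm.trans hv)]
    rw [← Finset.sum_mul, ← Finset.mul_sum, sum_overlap_left hU hV, mul_one]
  calc ∑ i, w i * Real.exp (h i)
      ≤ ∑ i, (s * (w i * ∑ j, overlap U U₁ i j * Real.exp (h₁ j)) +
          t * (w i * ∑ j, overlap U U₂ i j * Real.exp (h₂ j))) := by
        refine Finset.sum_le_sum fun i _ => ?_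
        have h1 := convexOn_exp.2 (Set.mem_univ (∑ j, overlap U U₁ i j * h₁ j))
          (Set.mem_univ (∑ j, overlap U U₂ i j * h₂ j)) hs ht hst
        simp only [smul_eq_mul] at h1
        rw [← hh] at h1
        have h2 := mul_le_mul_of_nonneg_left (hj U₁ h₁ hU₁ i) hs
        have h3 := mul_le_mul_of_nonneg_left (hj U₂ h₂ hU₂ i) ht
        have h4 := mul_le_mul_of_nonneg_left (h1.trans (add_le_add h2 h3)) (hw i)
        linarith
    _ ≤ 1 := by
        rw [Finset.sum_add_distrib, ← Finset.mul_sum, ← Finset.mul_sum, hsum U₁ h₁ w₁ hU₁ hω₁,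
          hsum U₂ h₂ w₂ hU₂ hω₂]
        have h2 := mul_le_mul_of_nonneg_left hs₁ hs
        have h3 := mul_le_mul_of_nonneg_left hs₂ ht
        linarith

lemma norm_apply_le_one_of_unitary {U : Matrix κ κ ℂ} (hU : U.conjTranspose * U = 1) (i k : κ) :
    ‖U i k‖ ≤ 1 := by
  have h1 := sum_norm_sq_col hU k
  have h2 : ‖U i k‖ ^ 2 ≤ 1 := by
    rw [← h1]
    exact Finset.single_le_sum (f := fun i => ‖U i k‖ ^ 2) (fun _ _ => by positivity)
      (Finset.mem_univ i)
  nlinarith [norm_nonneg (U i k)]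

lemma IsState.norm_apply_le_one {ρ : Matrix κ κ ℂ} (hρ : IsState ρ) (i j : κ) : ‖ρ i j‖ ≤ 1 := by
  obtain ⟨U, r, hU, hr, rfl⟩ := exists_conjDiag_nonneg hρ.1
  have hr1 : ∑ i, r i = 1 := by
    have := hρ.2; rw [trace_conjDiag hU] at this; exact_mod_cast this
  rw [conjDiag, Matrix.mul_apply, ← hr1]
  refine (norm_sum_le _ _).trans (Finset.sum_le_sum fun k _ => ?_)
  rw [Matrix.mul_diagonal, Matrix.conjTranspose_apply, norm_mul, norm_mul, norm_star,
    Complex.norm_real, Real.norm_of_nonneg (hr k)]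
  have h1 := norm_apply_le_one_of_unitary hU i k
  have h2 := norm_apply_le_one_of_unitary hU j k
  calc ‖U i k‖ * r k * ‖U j k‖ ≤ 1 * r k * 1 := by
        have := hr k
        gcongr
    _ = r k := by ring

lemma isCompact_of_isClosed_of_isState {S : Set (Matrix κ κ ℂ)} (hS : IsClosed S)
    (hstate : ∀ ρ ∈ S, IsState ρ) : IsCompact S := by
  have hK : IsCompact (Set.univ.pi fun _ : κ => Set.univ.pi fun _ : κ =>
      Metric.closedBall (0 : ℂ) 1) :=
    isCompact_univ_pi fun _ => isCompact_univ_pi fun _ => isCompact_closedBall _ _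
  refine IsCompact.of_isClosed_subset (show @IsCompact (Matrix κ κ ℂ) _ _ from hK) hS ?_
  intro ρ hρ i _ j _
  simpa using (hstate ρ hρ).norm_apply_le_one i j

lemma continuous_trace_mul_re (H : Matrix κ κ ℂ) :
    Continuous fun ρ : Matrix κ κ ℂ => (ρ * H).trace.re :=
  Complex.continuous_re.comp (Continuous.matrix_trace (continuous_id.matrix_mul continuous_const))

lemma continuous_trace_mul_re' (ρ : Matrix κ κ ℂ) :
    Continuous fun H : Matrix κ κ ℂ => (ρ * H).trace.re :=
  Complex.continuous_re.comp (Continuous.matrix_trace (continuous_const.matrix_mul continuous_id))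

lemma isLinearMap_trace_mul_re (H : Matrix κ κ ℂ) :
    IsLinearMap ℝ fun ρ : Matrix κ κ ℂ => (ρ * H).trace.re :=
  ⟨fun a b => by simp [Matrix.add_mul], fun c a => by simp⟩

lemma isLinearMap_trace_mul_re' (ρ : Matrix κ κ ℂ) :
    IsLinearMap ℝ fun H : Matrix κ κ ℂ => (ρ * H).trace.re :=
  ⟨fun a b => by simp [Matrix.mul_add], fun c a => by simp⟩

/-- A single score operator that works for a whole convex closed set of states. -/
lemma exists_isScore_forall {S : Set (Matrix κ κ ℂ)} (hS : IsClosed S) (hSc : Convex ℝ S)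
    (hSne : S.Nonempty) (hstate : ∀ ρ ∈ S, IsState ρ) {ω : Matrix κ κ ℂ} (hω : ω.PosSemidef)
    {c : ℝ} (h : ∀ ρ ∈ S, ∃ H, IsScore ω H ∧ c < (ρ * H).trace.re) :
    ∃ H, IsScore ω H ∧ ∀ ρ ∈ S, c < (ρ * H).trace.re := by
  have hcpt := isCompact_of_isClosed_of_isState hS hstate
  obtain ⟨T, hT⟩ := hcpt.elim_finite_subcover
    (fun H : {H | IsScore ω H} => {ρ : Matrix κ κ ℂ | c < (ρ * (H : Matrix κ κ ℂ)).trace.re})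
    (fun H => isOpen_lt continuous_const (continuous_trace_mul_re _))
    (fun ρ hρ => by
      obtain ⟨H, hH, hlt⟩ := h ρ hρ
      exact Set.mem_iUnion.mpr ⟨⟨H, hH⟩, hlt⟩)
  refine Sion.exists_lt_iInf_of_lt_iInf_of_finite (X := S) (Y := {H | IsScore ω H})
    (f := fun ρ H => (ρ * H).trace.re) hSne hcpt
    (fun H _ => (continuous_trace_mul_re H).lowerSemicontinuous.lowerSemicontinuousOn _) ?_
    (convex_isScore hω)
    (fun ρ _ => (continuous_trace_mul_re' ρ).upperSemicontinuous.upperSemicontinuousOn _) ?_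
    hSc (s := Subtype.val '' (T : Set {H | IsScore ω H})) (T.finite_toSet.image _) ?_ ?_
  · intro H _
    exact (((isLinearMap_trace_mul_re H).mk'.convexOn convex_univ).subset
      (Set.subset_univ _) hSc).quasiconvexOn
  · intro ρ _
    exact (((isLinearMap_trace_mul_re' ρ).mk'.concaveOn convex_univ).subset
      (Set.subset_univ _) (convex_isScore hω)).quasiconcaveOn
  · rintro _ ⟨H, _, rfl⟩
    exact H.2
  · intro ρ hρ
    obtain ⟨H, hH⟩ := Set.mem_iUnion.mp (hT hρ)
    obtain ⟨hHT, hlt⟩ := Set.mem_iUnion.mp hH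
    exact ⟨H, ⟨H, hHT, rfl⟩, hlt⟩

end Minimax

section Symmetric
variable {ι : Type*} [Fintype ι] [DecidableEq ι] {n : ℕ}

/-- The joint type of a pair of index tuples: how often each pair of symbols occurs. -/
def pairCount (i j : Fin n → ι) : ι × ι → Fin (n + 1) :=
  fun q => ⟨(Finset.univ.filter fun k => (i k, j k) = q).card,
    Nat.lt_succ_of_le ((Finset.card_le_univ _).trans_eq (Fintype.card_fin n))⟩

/-- The matrices whose entries only depend on the joint type of the indices. -/
def typeMatrix (ι : Type*) [Fintype ι] [DecidableEq ι] (n : ℕ) :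
    ((ι × ι → Fin (n + 1)) → ℂ) →ₗ[ℂ] MatN ι n where
  toFun g := fun i j => g (pairCount i j)
  map_add' _ _ := rfl
  map_smul' _ _ := rfl

lemma finrank_range_typeMatrix_le :
    Module.finrank ℂ (LinearMap.range (typeMatrix ι n)) ≤
      (n + 1) ^ (Fintype.card ι * Fintype.card ι) := by
  refine (LinearMap.finrank_range_le _).trans (le_of_eq ?_)
  rw [Module.finrank_fintype_fun_eq_card, Fintype.card_fun, Fintype.card_fin, Fintype.card_prod]

lemma tensorPow_mem_range_typeMatrix (σ : MatC ι) :
    tensorPow σ n ∈ LinearMap.range (typeMatrix ι n) := by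
  refine ⟨fun c => ∏ q : ι × ι, σ q.1 q.2 ^ (c q : ℕ), ?_⟩
  ext i j
  change ∏ q : ι × ι, σ q.1 q.2 ^ (Finset.univ.filter fun k => (i k, j k) = q).card =
    ∏ k, σ (i k) (j k)
  rw [← Finset.prod_fiberwise Finset.univ (fun k => (i k, j k)) (fun k => σ (i k) (j k))]
  refine Finset.prod_congr rfl fun q _ => ?_
  rw [← Finset.prod_const]
  refine Finset.prod_congr rfl fun k hk => ?_
  rw [← (Finset.mem_filter.mp hk).2]

lemma exists_perm_of_card_fiber_eq {α β : Type*} [Fintype α] [DecidableEq β] {f g : α → β}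
    (h : ∀ b, (Finset.univ.filter fun a => f a = b).card =
      (Finset.univ.filter fun a => g a = b).card) : ∃ π : Equiv.Perm α, f ∘ π = g := by
  have e : ∀ b, Nonempty ({a // g a = b} ≃ {a // f a = b}) := by
    intro b
    refine ⟨Fintype.equivOfCardEq ?_⟩
    rw [Fintype.card_subtype, Fintype.card_subtype, h b]
  replace e := fun b => (e b).some
  refine ⟨(Equiv.sigmaFiberEquiv g).symm.trans
    ((Equiv.sigmaCongrRight e).trans (Equiv.sigmaFiberEquiv f)), ?_⟩
  funext a
  exact ((e (g a)) ⟨a, rfl⟩).2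

lemma mem_range_typeMatrix_of_permCopies {M : MatN ι n} (hM : ∀ π, permCopies π M = M) :
    M ∈ LinearMap.range (typeMatrix ι n) := by
  have hdep : ∀ i j i' j' : Fin n → ι, pairCount i j = pairCount i' j' → M i j = M i' j' := by
    intro i j i' j' h
    obtain ⟨π, hπ⟩ := exists_perm_of_card_fiber_eq (f := fun k => (i k, j k))
      (g := fun k => (i' k, j' k)) (fun q => by
        have := congrFun h q
        simpa [pairCount, Fin.ext_iff] using this)
    have h1 : i ∘ π = i' := by
      funext k; exact congrArg Prod.fst (congrFun hπ k)
    have h2 : j ∘ π = j' := by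
      funext k; exact congrArg Prod.snd (congrFun hπ k)
    rw [← h1, ← h2]
    exact (congrFun (congrFun (hM π) i) j).symm
  refine ⟨fun c => if h : ∃ p : (Fin n → ι) × (Fin n → ι), pairCount p.1 p.2 = c
    then M h.choose.1 h.choose.2 else 0, ?_⟩
  ext i j
  have hex : ∃ p : (Fin n → ι) × (Fin n → ι), pairCount p.1 p.2 = pairCount i j := ⟨(i, j), rfl⟩
  change (if h : ∃ p : (Fin n → ι) × (Fin n → ι), pairCount p.1 p.2 = pairCount i j
    then M h.choose.1 h.choose.2 else 0) = M i j
  rw [dif_pos hex]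
  exact hdep _ _ _ _ hex.choose_spec

lemma permCopies_mul (π : Equiv.Perm (Fin n)) (M N : MatN ι n) :
    permCopies π (M * N) = permCopies π M * permCopies π N := by
  have h := Matrix.submatrix_mul_equiv M N (fun i : Fin n → ι => i ∘ π)
    (π.symm.arrowCongr (Equiv.refl ι)) (fun i : Fin n → ι => i ∘ π)
  exact h.symm

lemma permCopies_one (π : Equiv.Perm (Fin n)) : permCopies π (1 : MatN ι n) = 1 := by
  ext i j
  change (1 : MatN ι n) (i ∘ π) (j ∘ π) = _
  rw [Matrix.one_apply, Matrix.one_apply]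
  congr 1
  rw [eq_iff_iff]
  exact π.surjective.right_cancellable

lemma permCopies_pow {ω : MatN ι n} {π : Equiv.Perm (Fin n)} (h : permCopies π ω = ω) (k : ℕ) :
    permCopies π (ω ^ k) = ω ^ k := by
  induction k with
  | zero => rw [pow_zero, permCopies_one]
  | succ k ih => rw [pow_succ, permCopies_mul, ih, h]

lemma aeval_mul_of_conjDiag {κ : Type*} [Fintype κ] [DecidableEq κ] {U : Matrix κ κ ℂ}
    (hU : U.conjTranspose * U = 1) (w : κ → ℝ) (p : Polynomial ℂ) :
    Polynomial.aeval (conjDiag U w) p * U = U * Matrix.diagonal (fun i => p.eval (w i : ℂ)) := by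
  induction p using Polynomial.induction_on with
  | C a =>
    ext i j
    rw [Polynomial.aeval_C, Matrix.mul_diagonal, Algebra.algebraMap_eq_smul_one, Matrix.smul_mul,
      Matrix.one_mul]
    simp [mul_comm]
  | add p q hp hq =>
    rw [map_add, Matrix.add_mul, hp, hq, ← Matrix.mul_add, Matrix.diagonal_add]
    simp
  | monomial k a ih =>
    have : (Polynomial.C a * Polynomial.X ^ (k + 1) : Polynomial ℂ) =
        (Polynomial.C a * Polynomial.X ^ k) * Polynomial.X := by ring
    rw [this, map_mul, Polynomial.aeval_X, Matrix.mul_assoc, conjDiag_mul hU, ← Matrix.mul_assoc,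
      ih, Matrix.mul_assoc, Matrix.diagonal_mul_diagonal]
    simp only [Polynomial.eval_mul, Polynomial.eval_X]

/-- A permutation invariant operator has polynomially many distinct eigenvalues. -/
lemma card_image_le_of_permCopies {U : MatN ι n} (hU : U.conjTranspose * U = 1)
    {w : (Fin n → ι) → ℝ} (hω : ∀ π, permCopies π (conjDiag U w) = conjDiag U w) :
    (Finset.univ.image w).card ≤ (n + 1) ^ (Fintype.card ι * Fintype.card ι) := by
  set v := (Finset.univ.image w).card with hv
  have hU' : U * U.conjTranspose = 1 := mul_eq_one_comm.mp hU
  let L : Polynomial.degreeLT ℂ v →ₗ[ℂ] MatN ι n :=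
    (Polynomial.aeval (conjDiag U w)).toLinearMap.comp (Polynomial.degreeLT ℂ v).subtype
  have hmem : ∀ p, L p ∈ LinearMap.range (typeMatrix ι n) := by
    intro p
    have : L p = Polynomial.aeval (conjDiag U w) (p : Polynomial ℂ) := rfl
    rw [this, Polynomial.aeval_eq_sum_range]
    exact Submodule.sum_mem _ fun k _ => Submodule.smul_mem _ _
      (mem_range_typeMatrix_of_permCopies fun π => permCopies_pow (hω π) k)
  have hinj : Function.Injective (L.codRestrict _ hmem) := by
    rw [← LinearMap.ker_eq_bot, LinearMap.ker_codRestrict, LinearMap.ker_eq_bot']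
    intro p hp
    have h1 : Polynomial.aeval (conjDiag U w) (p : Polynomial ℂ) = 0 := hp
    have h2 := aeval_mul_of_conjDiag hU w (p : Polynomial ℂ)
    rw [h1, Matrix.zero_mul] at h2
    have h3 : Matrix.diagonal (fun i => (p : Polynomial ℂ).eval (w i : ℂ)) = 0 := by
      have := congrArg (U.conjTranspose * ·) h2
      simpa [← Matrix.mul_assoc, hU] using this.symm
    have h4 : ∀ i, (p : Polynomial ℂ).eval (w i : ℂ) = 0 := by
      intro i
      have := congrFun (congrFun h3 i) i
      simpa using this
    have h5 : (p : Polynomial ℂ) = 0 := by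
      refine Polynomial.eq_zero_of_degree_lt_of_eval_finset_eq_zero
        ((Finset.univ.image w).map ⟨((↑) : ℝ → ℂ), Complex.ofReal_injective⟩) ?_ ?_
      · rw [Finset.card_map]
        exact Polynomial.mem_degreeLT.mp p.2
      · intro x hx
        obtain ⟨y, hy, rfl⟩ := Finset.mem_map.mp hx
        obtain ⟨i, _, rfl⟩ := Finset.mem_image.mp hy
        exact h4 i
    exact Subtype.ext h5
  have h6 := LinearMap.finrank_le_finrank_of_injective hinj
  rw [(Polynomial.degreeLTEquiv ℂ v).finrank_eq, Module.finrank_fintype_fun_eq_card,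
    Fintype.card_fin] at h6
  exact h6.trans finrank_range_typeMatrix_le

end Symmetric

section Spanner
variable {κ : Type*} [Fintype κ] [DecidableEq κ]

/-- Existence of a barycentric spanner of a compact set of matrices. -/
lemma exists_barycentric_spanner {K : Set (Matrix κ κ ℂ)} (hK : IsCompact K) {N : ℕ}
    (hN : Module.finrank ℂ (Submodule.span ℂ K) ≤ N) :
    ∃ r : ℕ, r ≤ N ∧ ∃ x : Fin r → Matrix κ κ ℂ, (∀ i, x i ∈ K) ∧
      ∀ y ∈ K, ∃ c : Fin r → ℂ, (∀ i, ‖c i‖ ≤ 1) ∧ y = ∑ i, c i • x i := by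
  obtain ⟨s, hsK, hspan, hli⟩ := exists_linearIndependent ℂ K
  have hfin : Finite s := hli.finite
  have : Fintype s := Fintype.ofFinite s
  have hcard : Fintype.card s ≤ N := by
    refine le_trans (le_of_eq ?_) hN
    rw [← hspan]
    have := finrank_span_eq_card hli
    rw [Subtype.range_coe] at this
    rw [this]
  let b := Module.Basis.span hli
  obtain ⟨g, hg⟩ := LinearMap.exists_extend b.equivFun.toLinearMap
  have hgW : ∀ z (hz : z ∈ Submodule.span ℂ (Set.range ((↑) : s → Matrix κ κ ℂ))),
      g z = b.equivFun ⟨z, hz⟩ := fun z hz => by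
    have := LinearMap.congr_fun hg ⟨z, hz⟩
    simpa using this
  have hginj : ∀ z ∈ Submodule.span ℂ K, g z = 0 → z = 0 := by
    intro z hz h0
    rw [← hspan, ← Subtype.range_coe (s := s)] at hz
    rw [hgW z hz] at h0
    have := b.equivFun.map_eq_zero_iff.mp h0
    exact congrArg Subtype.val this
  have hgs : ∀ i : s, g (i : Matrix κ κ ℂ) = Pi.single i 1 := by
    intro i
    have hi : (i : Matrix κ κ ℂ) ∈ Submodule.span ℂ (Set.range ((↑) : s → Matrix κ κ ℂ)) :=
      Submodule.subset_span ⟨i, rfl⟩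
    rw [hgW _ hi]
    have h1 : (⟨(i : Matrix κ κ ℂ), hi⟩ : Submodule.span ℂ (Set.range ((↑) : s → Matrix κ κ ℂ))) =
        b i := by
      apply Subtype.ext
      rw [Module.Basis.span_apply]
    rw [h1]
    ext j
    rw [Module.Basis.equivFun_self, Pi.single_apply]
    simp [eq_comm]
  have hgc : Continuous g := LinearMap.continuous_of_finiteDimensional g
  set M : (s → Matrix κ κ ℂ) → Matrix s s ℂ := fun x => Matrix.of fun i => g (x i) with hM
  have hMc : Continuous M := by
    refine continuous_pi fun i => ?_
    exact hgc.comp (continuous_apply i)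
  obtain ⟨x, hxK, hmax⟩ := (isCompact_univ_pi fun _ : s => hK).exists_isMaxOn
    (⟨fun i => (i : Matrix κ κ ℂ), fun i _ => hsK i.2⟩)
    (f := fun x => ‖(M x).det‖) (hMc.matrix_det.norm.continuousOn)
  have hdet1 : 1 ≤ ‖(M x).det‖ := by
    have h1 := hmax (a := fun i => (i : Matrix κ κ ℂ)) (fun i _ => hsK i.2)
    have h2 : M (fun i => (i : Matrix κ κ ℂ)) = 1 := by
      ext i j
      change g (i : Matrix κ κ ℂ) j = _
      rw [hgs, Matrix.one_apply, Pi.single_apply]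
      simp [eq_comm]
    simpa [h2] using h1
  have hdet0 : (M x).det ≠ 0 := by
    intro h; rw [h, norm_zero] at hdet1; linarith
  have key : ∀ y ∈ K, ∃ c : s → ℂ, (∀ i, ‖c i‖ ≤ 1) ∧ y = ∑ i, c i • x i := by
    intro y hy
    refine ⟨fun i => ((M x).det)⁻¹ * Matrix.cramer (M x).transpose (g y) i, ?_, ?_⟩
    · intro i
      beta_reduce
      rw [Matrix.cramer_transpose_apply, norm_mul, norm_inv, inv_mul_le_one₀ (by linarith)]
      have h1 := hmax (a := Function.update x i y) (fun j _ => by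
        by_cases h : j = i
        · subst h; simpa using hy
        · rw [Function.update_of_ne h]; exact hxK j trivial)
      have h2 : M (Function.update x i y) = (M x).updateRow i (g y) := by
        ext j k
        by_cases h : j = i
        · subst h; simp [hM]
        · rw [Matrix.updateRow_ne h]; simp [hM, Function.update_of_ne h]
      rw [← h2]; exact h1
    · rw [← sub_eq_zero]
      refine hginj _ ?_ ?_
      · refine Submodule.sub_mem _ (Submodule.subset_span hy) (Submodule.sum_mem _ fun i _ =>
          Submodule.smul_mem _ _ (Submodule.subset_span (hxK i trivial)))
      · rw [map_sub, map_sum]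
        have h1 := Matrix.mulVec_cramer (M x).transpose (g y)
        rw [Matrix.det_transpose] at h1
        have h2 : ∑ i, g ((((M x).det)⁻¹ * Matrix.cramer (M x).transpose (g y) i) • x i) =
            ((M x).det)⁻¹ • (M x).transpose.mulVec (Matrix.cramer (M x).transpose (g y)) := by
          ext k
          rw [Finset.sum_apply, Pi.smul_apply, Matrix.mulVec, dotProduct, Finset.smul_sum]
          refine Finset.sum_congr rfl fun i _ => ?_
          have h3 : M x i k = g (x i) k := rfl
          rw [map_smul, Pi.smul_apply, smul_eq_mul, smul_eq_mul, Matrix.transpose_apply, h3]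
          ring
        rw [h2, h1, smul_smul, inv_mul_cancel₀ hdet0, one_smul, sub_self]
  let e := Fintype.equivFin s
  refine ⟨Fintype.card s, hcard, fun i => x (e.symm i), fun i => hxK _ trivial, fun y hy => ?_⟩
  obtain ⟨c, hc, hyc⟩ := key y hy
  refine ⟨fun i => c (e.symm i), fun i => hc _, ?_⟩
  rw [hyc]
  exact (Equiv.sum_comp e.symm fun i => c i • x i).symm

end Spanner

section TensorPower
variable {ι : Type*} [Fintype ι] [DecidableEq ι] {n : ℕ}

lemma tensorPow_mul (A B : MatC ι) (n : ℕ) :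
    tensorPow (A * B) n = tensorPow A n * tensorPow B n := by
  ext i j
  simp only [tensorPow, Matrix.mul_apply]
  rw [Finset.prod_univ_sum, Fintype.piFinset_univ]
  exact Finset.sum_congr rfl fun f _ => Finset.prod_mul_distrib

lemma conjTranspose_tensorPow (A : MatC ι) (n : ℕ) :
    (tensorPow A n).conjTranspose = tensorPow A.conjTranspose n := by
  ext i j
  simp [tensorPow, Matrix.conjTranspose_apply]

lemma trace_tensorPow (A : MatC ι) (n : ℕ) : (tensorPow A n).trace = A.trace ^ n := by
  have h := Finset.prod_univ_sum (fun _ : Fin n => (Finset.univ : Finset ι)) fun _ i => A i i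
  rw [Finset.prod_const, Finset.card_univ, Fintype.card_fin, Fintype.piFinset_univ] at h
  exact h.symm

lemma posSemidef_tensorPow {A : MatC ι} (hA : A.PosSemidef) (n : ℕ) :
    (tensorPow A n).PosSemidef := by
  obtain ⟨U, h, hU, hh, rfl⟩ := exists_conjDiag_nonneg hA
  have h1 : conjDiag U h = (conjDiag U fun i => √(h i)).conjTranspose *
      conjDiag U fun i => √(h i) := by
    rw [(conjDiag_isHermitian U _).eq, conjDiag_mul_conjDiag hU]
    congr 1
    ext i
    exact (Real.mul_self_sqrt (hh i)).symm
  rw [h1, tensorPow_mul, ← conjTranspose_tensorPow]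
  exact Matrix.posSemidef_conjTranspose_mul_self _

lemma IsState.tensorPow {σ : MatC ι} (hσ : IsState σ) (n : ℕ) : IsState (tensorPow σ n) :=
  ⟨posSemidef_tensorPow hσ.1 n, by rw [trace_tensorPow, hσ.2, one_pow]⟩

lemma permCopies_tensorPow (σ : MatC ι) (π : Equiv.Perm (Fin n)) :
    permCopies π (tensorPow σ n) = tensorPow σ n := by
  ext i j
  exact Equiv.prod_comp π fun k => σ (i k) (j k)

lemma continuous_tensorPow (n : ℕ) : Continuous fun σ : MatC ι => tensorPow σ n := by
  refine continuous_matrix fun i j => ?_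
  exact continuous_finsetProd _ fun k _ => continuous_id.matrix_elem _ _

end TensorPower

section Mixture
variable {ι : Type*} [Fintype ι] [DecidableEq ι] {n : ℕ} {C : Set (MatC ι)}

lemma measurable_tensorPow_apply (i j : Fin n → ι) :
    Measurable fun σ : C => tensorPow (σ : MatC ι) n i j := by
  refine Finset.measurable_prod _ fun k _ => ?_
  exact (measurable_pi_apply (j k)).comp ((measurable_pi_apply (i k)).comp measurable_subtype_coe)

lemma integrable_tensorPow_apply (hC : ∀ σ ∈ C, IsState σ) (μ : Measure C) [IsFiniteMeasure μ]
    (i j : Fin n → ι) : Integrable (fun σ : C => tensorPow (σ : MatC ι) n i j) μ :=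
  .of_bound (measurable_tensorPow_apply i j).aestronglyMeasurable 1
    (.of_forall fun σ => ((hC σ σ.2).tensorPow n).norm_apply_le_one i j)

lemma integrable_trace_tensorPow_mul (hC : ∀ σ ∈ C, IsState σ) (μ : Measure C)
    [IsFiniteMeasure μ] (X : MatN ι n) :
    Integrable (fun σ : C => (tensorPow (σ : MatC ι) n * X).trace) μ := by
  simp only [Matrix.trace, Matrix.diag_apply, Matrix.mul_apply]
  exact integrable_finsetSum _ fun i _ => integrable_finsetSum _ fun j _ =>
    (integrable_tensorPow_apply hC μ i j).mul_const _

lemma trace_iidMix_mul (hC : ∀ σ ∈ C, IsState σ) (μ : Measure C) [IsFiniteMeasure μ]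
    (X : MatN ι n) :
    (iidMix μ n * X).trace = ∫ σ : C, (tensorPow (σ : MatC ι) n * X).trace ∂μ := by
  simp only [Matrix.trace, Matrix.diag_apply, Matrix.mul_apply]
  rw [integral_finsetSum _ fun i _ => integrable_finsetSum _ fun j _ =>
    (integrable_tensorPow_apply hC μ i j).mul_const _]
  refine Finset.sum_congr rfl fun i _ => ?_
  rw [integral_finsetSum _ fun j _ => (integrable_tensorPow_apply hC μ i j).mul_const _]
  exact Finset.sum_congr rfl fun j _ => (integral_mul_const _ _).symm

lemma trace_iidMix_mul_re (hC : ∀ σ ∈ C, IsState σ) (μ : Measure C) [IsFiniteMeasure μ]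
    (X : MatN ι n) :
    (iidMix μ n * X).trace.re = ∫ σ : C, (tensorPow (σ : MatC ι) n * X).trace.re ∂μ := by
  rw [trace_iidMix_mul hC]
  exact (integral_re (integrable_trace_tensorPow_mul hC μ X)).symm

lemma isState_iidMix (hC : ∀ σ ∈ C, IsState σ) (μ : Measure C) [IsProbabilityMeasure μ] (n : ℕ) :
    IsState (iidMix μ n) := by
  have hH : (iidMix μ n).IsHermitian := by
    ext i j
    rw [Matrix.conjTranspose_apply]
    change star (∫ σ : C, tensorPow (σ : MatC ι) n j i ∂μ) =
      ∫ σ : C, tensorPow (σ : MatC ι) n i j ∂μ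
    refine (integral_conj (𝕜 := ℂ)).symm.trans (integral_congr_ae (.of_forall fun σ => ?_))
    exact ((hC σ σ.2).tensorPow n).1.1.apply i j
  refine ⟨.of_dotProduct_mulVec_nonneg hH fun x => ?_, ?_⟩
  · have h1 : dotProduct (star x) ((iidMix μ n).mulVec x) =
        (iidMix μ n * Matrix.vecMulVec x (star x)).trace := by
      rw [Matrix.mul_vecMulVec, Matrix.trace_vecMulVec, dotProduct_comm]
    refine Complex.nonneg_iff.mpr ⟨?_, (hH.im_star_dotProduct_mulVec_self x).symm⟩
    rw [h1, trace_iidMix_mul_re hC]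
    exact integral_nonneg fun σ => trace_mul_re_nonneg ((hC σ σ.2).tensorPow n).1
      (Matrix.posSemidef_vecMulVec_self_star x)
  · have := trace_iidMix_mul hC μ (1 : MatN ι n)
    rw [mul_one] at this
    rw [this]
    simp only [mul_one]
    rw [integral_congr_ae (f := fun σ : C => (tensorPow (σ : MatC ι) n).trace)
      (g := fun _ => (1 : ℂ)) (.of_forall fun σ => ((hC σ σ.2).tensorPow n).2)]
    simp

lemma permCopies_iidMix (μ : Measure C) (π : Equiv.Perm (Fin n)) :
    permCopies π (iidMix μ n) = iidMix μ n := by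
  ext i j
  change ∫ σ : C, tensorPow (σ : MatC ι) n (i ∘ π) (j ∘ π) ∂μ = _
  refine integral_congr_ae (.of_forall fun σ => ?_)
  exact congrFun (congrFun (permCopies_tensorPow (σ : MatC ι) π) i) j

lemma trace_mul_im_eq_zero {κ : Type*} [Fintype κ] {A B : Matrix κ κ ℂ} (hA : A.IsHermitian)
    (hB : B.IsHermitian) : (A * B).trace.im = 0 := by
  have h : star (A * B).trace = (A * B).trace := by
    rw [← Matrix.trace_conjTranspose, Matrix.conjTranspose_mul, hA.eq, hB.eq, Matrix.trace_mul_comm]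
  exact Complex.conj_eq_iff_im.mp h

/-- A compact set of states contains polynomially many states whose `n`-fold powers dominate
the `n`-fold power of every other one. -/
lemma exists_dominating_family (hC : ∀ σ ∈ C, IsState σ) (hCc : IsClosed C) (n : ℕ) :
    ∃ r : ℕ, r ≤ (n + 1) ^ (Fintype.card ι * Fintype.card ι) ∧ ∃ s : Fin r → C,
      ∀ σ ∈ C, ∀ X : MatN ι n, X.PosSemidef →
        (tensorPow σ n * X).trace.re ≤ ∑ i, (tensorPow (s i : MatC ι) n * X).trace.re := by
  have hK : IsCompact ((fun σ : MatC ι => tensorPow σ n) '' C) :=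
    (isCompact_of_isClosed_of_isState hCc hC).image (continuous_tensorPow n)
  have hN : Module.finrank ℂ (Submodule.span ℂ ((fun σ : MatC ι => tensorPow σ n) '' C)) ≤
      (n + 1) ^ (Fintype.card ι * Fintype.card ι) := by
    refine le_trans (Submodule.finrank_mono ?_) finrank_range_typeMatrix_le
    rw [Submodule.span_le]
    rintro _ ⟨σ, -, rfl⟩
    exact tensorPow_mem_range_typeMatrix σ
  obtain ⟨r, hr, x, hx, hspan⟩ := exists_barycentric_spanner hK hN
  choose s hsC hsx using hx
  refine ⟨r, hr, fun i => ⟨s i, hsC i⟩, fun σ hσ X hX => ?_⟩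
  obtain ⟨c, hc, hy⟩ := hspan _ ⟨σ, hσ, rfl⟩
  simp only at hy hsx
  rw [hy, Finset.sum_mul, Matrix.trace_sum, Complex.re_sum]
  refine Finset.sum_le_sum fun i _ => ?_
  rw [← hsx i, Matrix.smul_mul, Matrix.trace_smul, smul_eq_mul]
  have hp := ((hC _ (hsC i)).tensorPow n).1
  have h0 := trace_mul_re_nonneg hp hX
  rw [Complex.mul_re, trace_mul_im_eq_zero hp.1 hX.1, mul_zero, sub_zero]
  exact (mul_le_mul_of_nonneg_right ((Complex.re_le_norm _).trans (hc i)) h0).trans_eq (one_mul _)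

/-- A single mixture of i.i.d. states dominates all of them up to a polynomial factor. -/
lemma exists_universal_measure (hC : ∀ σ ∈ C, IsState σ) (hCc : IsClosed C) (hne : C.Nonempty) :
    ∃ μ : Measure C, IsProbabilityMeasure μ ∧ ∃ M : ℝ, 0 < M ∧ ∃ D : ℕ, ∀ n : ℕ, ∀ σ ∈ C,
      ∀ X : MatN ι n, X.PosSemidef →
        (tensorPow σ n * X).trace.re ≤ M * (n + 1 : ℝ) ^ D * (iidMix μ n * X).trace.re := by
  choose r hr s hs using fun n => exists_dominating_family hC hCc n
  set D := Fintype.card ι * Fintype.card ι with hD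
  set b : ℕ → ℝ := fun n => ((n + 1 : ℝ) ^ (D + 2))⁻¹ with hb
  have hb0 : ∀ n, 0 < b n := fun n => by positivity
  set ν : ℕ → Measure C := fun n => ENNReal.ofReal (b n) • ∑ i, Measure.dirac (s n i) with hν
  have hνu : ∀ n, ν n Set.univ = ENNReal.ofReal (b n * r n) := by
    intro n
    simp [hν, ENNReal.ofReal_mul (hb0 n).le]
  have hr0 : 0 < r 0 := by
    obtain ⟨σ, hσ⟩ := hne
    by_contra! h
    have h1 := hs 0 σ hσ 1 Matrix.PosSemidef.one
    rw [mul_one, ((hC σ hσ).tensorPow 0).2] at h1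
    have : IsEmpty (Fin (r 0)) := by rw [Nat.le_zero.mp h]; infer_instance
    rw [Finset.univ_eq_empty, Finset.sum_empty, Complex.one_re] at h1
    linarith
  set Z := Measure.sum ν Set.univ with hZ
  have hZsum : Z = ∑' n, ν n Set.univ := Measure.sum_apply _ MeasurableSet.univ
  have hZtop : Z ≠ ⊤ := by
    have hsum : Summable fun n : ℕ => ((n + 1 : ℝ) ^ 2)⁻¹ := by
      have := (summable_nat_add_iff 1).mpr (Real.summable_nat_pow_inv.mpr one_lt_two)
      simpa using this
    have hle : Z ≤ ∑' n : ℕ, ENNReal.ofReal ((n + 1 : ℝ) ^ 2)⁻¹ := by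
      rw [hZsum]
      refine ENNReal.tsum_le_tsum fun n => ?_
      rw [hνu]
      refine ENNReal.ofReal_le_ofReal ?_
      have h1 : (r n : ℝ) ≤ (n + 1 : ℝ) ^ D := by exact_mod_cast hr n
      have h2 : b n * (n + 1 : ℝ) ^ D = ((n + 1 : ℝ) ^ 2)⁻¹ := by
        simp only [hb, pow_add]
        field_simp
      rw [← h2]
      exact mul_le_mul_of_nonneg_left h1 (hb0 n).le
    rw [← ENNReal.ofReal_tsum_of_nonneg (fun n => by positivity) hsum] at hle
    exact ne_top_of_le_ne_top ENNReal.ofReal_ne_top hle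
  have hZ0 : Z ≠ 0 := by
    intro h
    have h1 : ν 0 Set.univ ≤ Z := Measure.le_sum ν 0 Set.univ
    rw [h, hνu, nonpos_iff_eq_zero, ENNReal.ofReal_eq_zero] at h1
    exact absurd h1 (not_le.mpr (mul_pos (hb0 0) (by exact_mod_cast hr0)))
  have hprob : IsProbabilityMeasure (Z⁻¹ • Measure.sum ν) := by
    refine ⟨?_⟩
    rw [Measure.smul_apply, smul_eq_mul, ← hZ, ENNReal.inv_mul_cancel hZ0 hZtop]
  refine ⟨Z⁻¹ • Measure.sum ν, hprob, Z.toReal, ENNReal.toReal_pos hZ0 hZtop, D + 2,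
    fun n σ hσ X hX => ?_⟩
  set f : C → ℝ := fun σ => (tensorPow (σ : MatC ι) n * X).trace.re with hf
  have hfm : StronglyMeasurable f := by
    have hm : Measurable fun σ : C => (tensorPow (σ : MatC ι) n * X).trace := by
      simp only [Matrix.trace, Matrix.diag_apply, Matrix.mul_apply]
      exact Finset.measurable_sum _ fun i _ => Finset.measurable_sum _ fun j _ =>
        (measurable_tensorPow_apply i j).mul_const _
    exact (Complex.measurable_re.comp hm).stronglyMeasurable
  have hmono : ∫ σ, f σ ∂(Z⁻¹ • ν n) ≤ ∫ σ, f σ ∂(Z⁻¹ • Measure.sum ν) := by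
    refine integral_mono_measure ?_ (.of_forall fun σ => ?_)
      (integrable_trace_tensorPow_mul hC _ X).re
    · exact Measure.le_iff.mpr fun t _ => by
        simp only [Measure.smul_apply, smul_eq_mul]
        exact mul_le_mul_right (Measure.le_sum ν n t) _
    · exact trace_mul_re_nonneg ((hC σ σ.2).tensorPow n).1 hX
  rw [show ∫ σ, f σ ∂(Z⁻¹ • Measure.sum ν) = _ from
      (trace_iidMix_mul_re hC (Z⁻¹ • Measure.sum ν) X).symm,
    integral_smul_measure, integral_smul_measure,
    integral_finsetSum_measure (fun i _ => by
      exact ((integrable_trace_tensorPow_mul hC (Measure.dirac (s n i)) X).re)),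
    ENNReal.toReal_ofReal (hb0 n).le, ENNReal.toReal_inv] at hmono
  simp only [integral_dirac' f _ hfm, smul_eq_mul] at hmono
  have hZr := ENNReal.toReal_pos hZ0 hZtop
  have hP : (0 : ℝ) < (n + 1 : ℝ) ^ (D + 2) := by positivity
  have h1 := hs n σ hσ X hX
  rw [inv_mul_le_iff₀ hZr] at hmono
  simp only [hb] at hmono
  rw [inv_mul_le_iff₀ hP] at hmono
  refine h1.trans (hmono.trans_eq ?_)
  ring

end Mixture

section TensorProduct
variable {ι : Type*} [Fintype ι] [DecidableEq ι] {n k : ℕ}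

lemma sum_append {M : Type*} [AddCommMonoid M] (f : (Fin (n + k) → ι) → M) :
    ∑ i, f i = ∑ a : Fin n → ι, ∑ b : Fin k → ι, f (Fin.append a b) := by
  rw [← Fintype.sum_prod_type' (f := fun a b => f (Fin.append a b))]
  exact (Equiv.sum_comp (Fin.appendEquiv n k) f).symm

lemma tensorMul_append (X : MatN ι n) (Y : MatN ι k) (a a' : Fin n → ι) (b b' : Fin k → ι) :
    tensorMul X Y (Fin.append a b) (Fin.append a' b') = X a a' * Y b b' := by
  simp [tensorMul]

lemma tensorMul_mul (X X' : MatN ι n) (Y Y' : MatN ι k) :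
    tensorMul X Y * tensorMul X' Y' = tensorMul (X * X') (Y * Y') := by
  ext i j
  rw [Matrix.mul_apply, sum_append]
  simp only [tensorMul, Fin.append_left, Fin.append_right, Matrix.mul_apply]
  rw [Finset.sum_mul_sum]
  exact Finset.sum_congr rfl fun a _ => Finset.sum_congr rfl fun b _ => by ring

lemma conjTranspose_tensorMul (X : MatN ι n) (Y : MatN ι k) :
    (tensorMul X Y).conjTranspose = tensorMul X.conjTranspose Y.conjTranspose := by
  ext i j
  simp [tensorMul, Matrix.conjTranspose_apply]

lemma tensorMul_diagonal (f : (Fin n → ι) → ℂ) (g : (Fin k → ι) → ℂ) :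
    tensorMul (Matrix.diagonal f) (Matrix.diagonal g) =
      Matrix.diagonal fun i : Fin (n + k) → ι =>
        f (fun t => i (Fin.castAdd k t)) * g (fun t => i (Fin.natAdd n t)) := by
  ext i j
  obtain ⟨⟨a, b⟩, rfl⟩ := (Fin.appendEquiv n k).surjective i
  obtain ⟨⟨a', b'⟩, rfl⟩ := (Fin.appendEquiv n k).surjective j
  have h : Fin.append a b = Fin.append a' b' ↔ a = a' ∧ b = b' :=
    ((Fin.appendEquiv n k).injective.eq_iff (a := (a, b)) (b := (a', b'))).trans Prod.mk_inj
  change tensorMul _ _ (Fin.append a b) (Fin.append a' b') =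
    Matrix.diagonal _ (Fin.append a b) (Fin.append a' b')
  rw [tensorMul_append, Matrix.diagonal_apply, Matrix.diagonal_apply, Matrix.diagonal_apply]
  simp only [h, Fin.append_left, Fin.append_right]
  by_cases h1 : a = a' <;> by_cases h2 : b = b' <;> simp [h1, h2]

lemma tensorMul_one_one : tensorMul (1 : MatN ι n) (1 : MatN ι k) = 1 := by
  have := tensorMul_diagonal (ι := ι) (n := n) (k := k) (fun _ => 1) fun _ => 1
  simpa using this

lemma tensorMul_conjDiag (U : MatN ι n) (V : MatN ι k) (f : (Fin n → ι) → ℝ)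
    (g : (Fin k → ι) → ℝ) :
    tensorMul (conjDiag U f) (conjDiag V g) = conjDiag (tensorMul U V) fun i =>
      f (fun t => i (Fin.castAdd k t)) * g (fun t => i (Fin.natAdd n t)) := by
  simp only [conjDiag, ← tensorMul_mul, conjTranspose_tensorMul, tensorMul_diagonal,
    Complex.ofReal_mul]

lemma tensorMul_unitary {U : MatN ι n} {V : MatN ι k} (hU : U.conjTranspose * U = 1)
    (hV : V.conjTranspose * V = 1) : (tensorMul U V).conjTranspose * tensorMul U V = 1 := by
  rw [conjTranspose_tensorMul, tensorMul_mul, hU, hV, tensorMul_one_one]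

lemma trace_tensorMul (X : MatN ι n) (Y : MatN ι k) :
    (tensorMul X Y).trace = X.trace * Y.trace := by
  simp only [Matrix.trace, Matrix.diag_apply]
  rw [sum_append, Finset.sum_mul_sum]
  simp only [tensorMul_append]

lemma tensorPow_add (σ : MatC ι) (n k : ℕ) :
    tensorPow σ (n + k) = tensorMul (tensorPow σ n) (tensorPow σ k) := by
  ext i j
  exact Fin.prod_univ_add _

lemma trace_mul_tensorMul (ρ : MatN ι (n + k)) (X : MatN ι n) (F : MatN ι k) :
    (ρ * tensorMul X F).trace = (condReduce ρ F * X).trace := by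
  simp only [Matrix.trace, Matrix.diag_apply, Matrix.mul_apply, condReduce]
  rw [sum_append]
  simp only [sum_append, tensorMul_append]
  refine Finset.sum_congr rfl fun a _ => ?_
  rw [Finset.sum_comm]
  refine Finset.sum_congr rfl fun a' _ => ?_
  rw [Finset.sum_mul]
  refine Finset.sum_congr rfl fun b _ => ?_
  rw [Finset.sum_mul]
  exact Finset.sum_congr rfl fun b' _ => by ring

lemma trace_submatrix_mul_submatrix {κ κ' : Type*} [Fintype κ] [Fintype κ'] (e : κ' ≃ κ)
    (X Y : Matrix κ κ ℂ) : (X.submatrix e e * Y.submatrix e e).trace = (X * Y).trace := by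
  rw [Matrix.submatrix_mul_equiv]
  exact Equiv.sum_comp e fun i => (X * Y) i i

end TensorProduct

section Marginals
variable {ι : Type*} [Fintype ι] [DecidableEq ι] {n k : ℕ} {A : ∀ n : ℕ, Set (MatN ι n)}

lemma AxiomQIII.relabel_mem (hA : AxiomQIII A) {a b : ℕ} (e : Fin a ≃ Fin b) {ρ : MatN ι a}
    (hρ : ρ ∈ A a) : (ρ.submatrix (fun i : Fin b → ι => i ∘ e) fun j => j ∘ e) ∈ A b := by
  obtain rfl : a = b := by simpa using Fintype.card_congr e
  exact hA _ ρ hρ e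

lemma condReduce_one_mem (hA : ∀ n : ℕ, ∀ ρ ∈ A n, IsState ρ) (hQIV : AxiomQIV A) (hk : 1 ≤ k)
    {ρ : MatN ι (k + n)} (hρ : ρ ∈ A (k + n)) : condReduce ρ (1 : MatN ι n) ∈ A k := by
  rcases Nat.eq_zero_or_pos n with rfl | hn
  · have h : condReduce ρ (1 : MatN ι 0) = ρ := by
      funext i j
      simp only [condReduce, Fintype.sum_unique]
      rw [Matrix.one_apply, if_pos (Subsingleton.elim _ _), mul_one]
      congr 1 <;> exact Fin.append_elim0 _
    rw [h]
    exact hρ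
  · obtain ⟨V, hV, h⟩ := hQIV n hn
    obtain ⟨l, ω, -, hω, hl⟩ := h 1 (mem_of_mem_nhds hV) Matrix.isHermitian_one k hk ρ hρ
    have htr := trace_mul_tensorMul ρ 1 (1 : MatN ι n)
    rw [tensorMul_one_one, mul_one, mul_one, (hA _ ρ hρ).2, hl, Matrix.trace_smul,
      (hA _ ω hω).2, smul_eq_mul, mul_one] at htr
    rw [hl, ← htr, one_smul]
    exact hω

/-- The marginal on the last `k` tensor factors. -/
lemma exists_marginal (hA : ∀ n : ℕ, ∀ ρ ∈ A n, IsState ρ) (hQIII : AxiomQIII A)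
    (hQIV : AxiomQIV A) (hk : 1 ≤ k) {ρ : MatN ι (n + k)} (hρ : ρ ∈ A (n + k)) :
    ∃ ω ∈ A k, ∀ F : MatN ι k, (ρ * tensorMul 1 F).trace = (ω * F).trace := by
  refine ⟨_, condReduce_one_mem hA hQIV hk (hQIII.relabel_mem finAddFlip hρ), fun F => ?_⟩
  rw [← trace_mul_tensorMul]
  let e : (Fin (k + n) → ι) ≃ (Fin (n + k) → ι) := Equiv.arrowCongr finAddFlip (Equiv.refl ι)
  have h : tensorMul F (1 : MatN ι n) = (tensorMul (1 : MatN ι n) F).submatrix e e := by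
    ext i j
    change F _ _ * (1 : MatN ι n) _ _ = (1 : MatN ι n) (fun t => i (finAddFlip (Fin.castAdd k t)))
      (fun t => j (finAddFlip (Fin.castAdd k t))) *
      F (fun t => i (finAddFlip (Fin.natAdd n t))) (fun t => j (finAddFlip (Fin.natAdd n t)))
    have h1 : ∀ i : Fin (k + n) → ι, (fun t => i (finAddFlip (Fin.castAdd k t))) =
        fun t => i (Fin.natAdd k t) := fun i => funext fun t => by rw [finAddFlip_apply_castAdd]
    rw [h1 i, h1 j]
    simp only [finAddFlip_apply_natAdd]
    exact mul_comm _ _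
  rw [h]
  exact (trace_submatrix_mul_submatrix e ρ (tensorMul 1 F)).symm

end Marginals

section BlockPower
variable {ι : Type*} {K : ℕ}

/-- The `m`-fold tensor power of a `K`-copy matrix. -/
def copyPow [DecidableEq ι] (G : MatN ι K) : ∀ m : ℕ, MatN ι (K * m)
  | 0 => 1
  | m + 1 => tensorMul (copyPow G m) G

/-- The sum of `h` over the `m` blocks of length `K` of an index. -/
def copySum (h : (Fin K → ι) → ℝ) : ∀ m : ℕ, (Fin (K * m) → ι) → ℝ
  | 0 => fun _ => 0
  | m + 1 => fun i => copySum h m (fun t => i (Fin.castAdd K t)) + h fun t => i (Fin.natAdd (K * m) t)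

/-- The product of `g` over the `m` blocks of length `K` of an index. -/
def copyProd (g : (Fin K → ι) → ℝ) : ∀ m : ℕ, (Fin (K * m) → ι) → ℝ
  | 0 => fun _ => 1
  | m + 1 => fun i =>
      copyProd g m (fun t => i (Fin.castAdd K t)) * g fun t => i (Fin.natAdd (K * m) t)

lemma copyProd_exp (h : (Fin K → ι) → ℝ) (m : ℕ) (i : Fin (K * m) → ι) :
    copyProd (fun x => Real.exp (h x)) m i = Real.exp (copySum h m i) := by
  induction m with
  | zero => exact Real.exp_zero.symm
  | succ m ih =>
    change copyProd _ m _ * _ = Real.exp (copySum h m _ + _)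
    rw [ih, Real.exp_add]

lemma copySum_affine (h : (Fin K → ι) → ℝ) (c e : ℝ) (m : ℕ) (i : Fin (K * m) → ι) :
    copySum (fun x => c * h x + e) m i = c * copySum h m i + m * e := by
  induction m with
  | zero => simp [copySum]
  | succ m ih =>
    change copySum _ m _ + _ = c * (copySum h m _ + _) + _
    rw [ih]
    push_cast
    ring

lemma copyProd_mono {f g : (Fin K → ι) → ℝ} (hf : ∀ x, 0 ≤ f x) (hfg : ∀ x, f x ≤ g x) (m : ℕ)
    (i : Fin (K * m) → ι) : 0 ≤ copyProd f m i ∧ copyProd f m i ≤ copyProd g m i := by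
  induction m with
  | zero => exact ⟨zero_le_one, le_rfl⟩
  | succ m ih =>
    obtain ⟨h1, h2⟩ := ih fun t => i (Fin.castAdd K t)
    exact ⟨mul_nonneg h1 (hf _), mul_le_mul h2 (hfg _) (hf _) (h1.trans h2)⟩

variable [Fintype ι] [DecidableEq ι]

lemma copyPow_conjDiag (U : MatN ι K) (g : (Fin K → ι) → ℝ) (m : ℕ) :
    copyPow (conjDiag U g) m = conjDiag (copyPow U m) (copyProd g m) := by
  induction m with
  | zero => simp [copyPow, copyProd, conjDiag]
  | succ m ih =>
    change tensorMul (copyPow _ m) _ = conjDiag (tensorMul _ _) _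
    rw [ih, tensorMul_conjDiag]
    rfl

lemma copyPow_unitary {U : MatN ι K} (hU : U.conjTranspose * U = 1) (m : ℕ) :
    (copyPow U m).conjTranspose * copyPow U m = 1 := by
  induction m with
  | zero => simp [copyPow]
  | succ m ih => exact tensorMul_unitary ih hU

lemma trace_tensorPow_mul_copyPow (σ : MatC ι) (G : MatN ι K) (m : ℕ) :
    (tensorPow σ (K * m) * copyPow G m).trace = (tensorPow σ K * G).trace ^ m := by
  induction m with
  | zero =>
    change (tensorPow σ 0 * 1).trace = _
    rw [mul_one, trace_tensorPow, pow_zero, pow_zero]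
  | succ m ih =>
    change (tensorPow σ (K * m + K) * tensorMul (copyPow G m) G).trace = _
    rw [tensorPow_add, tensorMul_mul, trace_tensorMul, ih, pow_succ]

lemma trace_mul_conjDiag_re_mono {κ : Type*} [Fintype κ] [DecidableEq κ] {ρ : Matrix κ κ ℂ}
    (hρ : ρ.PosSemidef) (U : Matrix κ κ ℂ) {f g : κ → ℝ} (h : ∀ i, f i ≤ g i) :
    (ρ * conjDiag U f).trace.re ≤ (ρ * conjDiag U g).trace.re := by
  rw [trace_mul_conjDiag, trace_mul_conjDiag, Complex.re_sum, Complex.re_sum]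
  refine Finset.sum_le_sum fun i _ => ?_
  rw [Complex.re_ofReal_mul, Complex.re_ofReal_mul]
  exact mul_le_mul_of_nonneg_right (h i) (diag_conj_nonneg hρ U i)

lemma trace_mul_conjDiag_re_smul {κ : Type*} [Fintype κ] [DecidableEq κ] (ρ U : Matrix κ κ ℂ)
    (c : ℝ) (f : κ → ℝ) :
    (ρ * conjDiag U fun i => c * f i).trace.re = c * (ρ * conjDiag U f).trace.re := by
  rw [trace_mul_conjDiag, trace_mul_conjDiag, Complex.re_sum, Complex.re_sum, Finset.mul_sum]
  refine Finset.sum_congr rfl fun i _ => ?_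
  rw [Complex.re_ofReal_mul, Complex.re_ofReal_mul, mul_assoc]

lemma trace_mul_copyPow_le_one {A : ∀ n : ℕ, Set (MatN ι n)} (hA : ∀ n : ℕ, ∀ ρ ∈ A n, IsState ρ)
    (hQIII : AxiomQIII A) (hQIV : AxiomQIV A) (hK : 1 ≤ K) {G : MatN ι K}
    (hG : ∀ n : ℕ, 1 ≤ n → ∀ ρ ∈ A (n + K),
      ∃ (lam : ℝ) (ω : MatN ι n), 0 ≤ lam ∧ ω ∈ A n ∧ condReduce ρ G = (lam : ℂ) • ω)
    (hG1 : ∀ ω ∈ A K, (ω * G).trace.re ≤ 1) (m : ℕ) :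
    ∀ ρ ∈ A (K * m), (ρ * copyPow G m).trace.re ≤ 1 := by
  have hmarg : ∀ n, ∀ ρ ∈ A (n + K), (ρ * tensorMul 1 G).trace.re ≤ 1 := fun n ρ hρ => by
    obtain ⟨ω, hω, h⟩ := exists_marginal hA hQIII hQIV hK hρ
    rw [h]
    exact hG1 ω hω
  induction m with
  | zero =>
    intro ρ hρ
    change (ρ * 1).trace.re ≤ 1
    rw [mul_one, (hA _ ρ hρ).2, Complex.one_re]
  | succ m ih =>
    intro ρ hρ
    rcases Nat.eq_zero_or_pos m with rfl | hm
    · exact hmarg _ ρ hρ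
    · change (ρ * tensorMul (copyPow G m) G).trace.re ≤ 1
      obtain ⟨l, ω, hl0, hω, hl⟩ := hG (K * m) (Nat.mul_pos hK hm) ρ hρ
      have h1 := hmarg _ ρ hρ
      rw [trace_mul_tensorMul, hl, mul_one, Matrix.trace_smul, (hA _ ω hω).2, smul_eq_mul,
        mul_one, Complex.ofReal_re] at h1
      rw [trace_mul_tensorMul, hl, Matrix.smul_mul, Matrix.trace_smul, smul_eq_mul,
        Complex.re_ofReal_mul]
      exact (mul_le_mul_of_nonneg_left (ih ω hω) hl0).trans (by simpa using h1)

lemma exp_neg_sub_le_one_sub {y : ℝ} (hy : |y| ≤ 1 / 2) : Real.exp (-y - 2 * y ^ 2) ≤ 1 - y := by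
  have h1 := Real.abs_log_sub_add_sum_range_le (x := y) (by linarith) 1
  have hy' := abs_le.mp hy
  have h2 : |y| ^ (1 + 1) / (1 - |y|) ≤ 2 * y ^ 2 := by
    rw [div_le_iff₀ (by linarith), ← sq_abs y]
    have h3 : 0 ≤ |y| ^ 2 * (1 - 2 * |y|) := mul_nonneg (sq_nonneg _) (by linarith)
    rw [one_add_one_eq_two]
    linarith
  rw [← Real.le_log_iff_exp_le (by linarith)]
  simp only [Finset.sum_range_one, Nat.cast_zero, zero_add, pow_one, div_one] at h1
  have := (abs_le.mp (h1.trans h2)).1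
  linarith

/-- A Chernoff-type test for the blockwise empirical mean of a Hermitian observable whose mean is
bounded below on `A K`. -/
lemma exists_chernoff_test {A : ∀ n : ℕ, Set (MatN ι n)} (hA : ∀ n : ℕ, ∀ ρ ∈ A n, IsState ρ)
    (hQIII : AxiomQIII A) (hQIV : AxiomQIV A) (hK : 1 ≤ K) {U : MatN ι K}
    (hU : U.conjTranspose * U = 1) (h : (Fin K → ι) → ℝ) {c γ : ℝ} (hγ : 0 < γ)
    (hc : ∀ ω ∈ A K, c ≤ (ω * conjDiag U h).trace.re) :
    ∃ δ : ℝ, 0 < δ ∧ ∀ m r : ℕ, 1 ≤ m → ∃ E : MatN ι (K * m + r),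
      E.PosSemidef ∧ (1 - E).PosSemidef ∧
      (∀ ρ ∈ A (K * m + r), (ρ * (1 - E)).trace.re ≤ Real.exp (-(m * δ))) ∧
      ∀ σ : MatC ι, IsState σ → (tensorPow σ (K * m + r) * E).trace.re ≤
        Real.exp (-(m * (c - γ))) *
          (tensorPow σ K * conjDiag U fun x => Real.exp (h x)).trace.re ^ m := by
  obtain ⟨V, hV, hcone⟩ := hQIV K hK
  obtain ⟨B, hB⟩ : ∃ B : ℝ, ∀ x, |h x - c| ≤ B := by
    obtain ⟨B, hB⟩ := (Set.finite_range fun x => |h x - c|).bddAbove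
    exact ⟨B, fun x => hB ⟨x, rfl⟩⟩
  have hcont : Tendsto (fun η : ℝ => conjDiag U fun x => 1 - η * (h x - c)) (𝓝 0) (𝓝 1) := by
    have h1 : Continuous fun η : ℝ => conjDiag U fun x => 1 - η * (h x - c) := by
      unfold conjDiag
      refine (continuous_const.matrix_mul (Continuous.matrix_diagonal ?_)).matrix_mul
        continuous_const
      fun_prop
    have h2 := h1.tendsto 0
    simp only [zero_mul, sub_zero] at h2
    have h3 : conjDiag U (fun _ => 1) = 1 := by
      simp [conjDiag, mul_eq_one_comm.mp hU]
    rwa [h3] at h2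
  have hev : ∀ᶠ η : ℝ in 𝓝[>] 0, conjDiag U (fun x => 1 - η * (h x - c)) ∈ V ∧
      η * B ≤ 1 / 2 ∧ 2 * η * B ^ 2 ≤ γ / 2 := by
    refine ((hcont.mono_left nhdsWithin_le_nhds).eventually hV).and
      (.and (Eventually.filter_mono nhdsWithin_le_nhds ?_)
        (Eventually.filter_mono nhdsWithin_le_nhds ?_))
    · have : Tendsto (fun η : ℝ => η * B) (𝓝 0) (𝓝 (0 * B)) := (continuous_mul_const B).tendsto 0
      exact this.eventually (ge_mem_nhds (by norm_num))
    · have : Tendsto (fun η : ℝ => 2 * η * B ^ 2) (𝓝 0) (𝓝 (2 * 0 * B ^ 2)) :=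
        (by fun_prop : Continuous fun η : ℝ => 2 * η * B ^ 2).tendsto 0
      exact this.eventually (ge_mem_nhds (by simpa using by linarith))
  obtain ⟨η, ⟨hηV, hη1, hη2⟩, hη0⟩ := (hev.and self_mem_nhdsWithin).exists
  change 0 < η at hη0
  set g : (Fin K → ι) → ℝ := fun x => 1 - η * (h x - c) with hg
  have hgexp : ∀ x, Real.exp (-η * h x + (η * c - η * γ / 2)) ≤ g x := by
    intro x
    have hx := hB x
    have h1 : |η * (h x - c)| ≤ η * B := by
      rw [abs_mul, abs_of_pos hη0]
      exact mul_le_mul_of_nonneg_left hx hη0.le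
    refine le_trans (Real.exp_le_exp.mpr ?_) (exp_neg_sub_le_one_sub (h1.trans hη1))
    have h2 : (h x - c) ^ 2 ≤ B ^ 2 := sq_le_sq' (by linarith [(abs_le.mp hx).1]) (abs_le.mp hx).2
    have h3 : 2 * (η * (h x - c)) ^ 2 ≤ η * (γ / 2) := by
      calc 2 * (η * (h x - c)) ^ 2 = η * (2 * η * (h x - c) ^ 2) := by ring
        _ ≤ η * (2 * η * B ^ 2) := by gcongr
        _ ≤ η * (γ / 2) := by gcongr
    linarith
  have hG1 : ∀ ω ∈ A K, (ω * conjDiag U g).trace.re ≤ 1 := by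
    intro ω hω
    have h1 : conjDiag U g = (((1 + η * c : ℝ) : ℂ)) • (1 : MatN ι K) - ((η : ℝ) : ℂ) • conjDiag U h := by
      have h2 : Matrix.diagonal (fun x => ((g x : ℝ) : ℂ)) =
          (((1 + η * c : ℝ) : ℂ)) • (1 : MatN ι K) -
            ((η : ℝ) : ℂ) • Matrix.diagonal fun x => ((h x : ℝ) : ℂ) := by
        rw [← Matrix.diagonal_one, ← Matrix.diagonal_smul, ← Matrix.diagonal_smul,
          Matrix.diagonal_sub]
        congr 1
        ext x
        simp only [hg, Pi.smul_apply, smul_eq_mul, mul_one]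
        push_cast
        ring
      simp only [conjDiag]
      rw [h2, Matrix.mul_sub, Matrix.sub_mul, Matrix.mul_smul, Matrix.smul_mul, mul_one,
        mul_eq_one_comm.mp hU, Matrix.mul_smul, Matrix.smul_mul]
    rw [h1, Matrix.mul_sub, Matrix.trace_sub, Matrix.mul_smul, Matrix.mul_smul, mul_one,
      Matrix.trace_smul, Matrix.trace_smul, (hA _ ω hω).2, smul_eq_mul, smul_eq_mul, mul_one,
      Complex.sub_re, Complex.ofReal_re, Complex.re_ofReal_mul]
    nlinarith [hc ω hω]
  have hle := trace_mul_copyPow_le_one hA hQIII hQIV hK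
    (hcone (conjDiag U g) hηV (conjDiag_isHermitian U g)) hG1
  refine ⟨η * γ / 2, by positivity, fun m r hm => ?_⟩
  set e : (Fin (K * m) → ι) → ℝ := fun i => if copySum h m i < m * (c - γ) then 0 else 1 with he
  have he0 : ∀ i, 0 ≤ e i := fun i => by simp only [he]; split_ifs <;> norm_num
  have he1 : ∀ i, 0 ≤ 1 - e i := fun i => by simp only [he]; split_ifs <;> norm_num
  have hW := copyPow_unitary hU m
  set W := copyPow U m with hWdef
  have hone : conjDiag (1 : MatN ι r) (fun _ => 1) = 1 := by simp [conjDiag]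
  have hT : ∀ f : (Fin (K * m) → ι) → ℝ, tensorMul (conjDiag W f) (1 : MatN ι r) =
      conjDiag (tensorMul W (1 : MatN ι r)) fun i => f (fun t => i (Fin.castAdd r t)) := by
    intro f
    rw [← hone, tensorMul_conjDiag, hone]
    simp only [mul_one]
  have hsub : 1 - tensorMul (conjDiag W e) (1 : MatN ι r) =
      tensorMul (conjDiag W fun i => 1 - e i) (1 : MatN ι r) := by
    have hWW : conjDiag W (fun i => 1 - e i) = 1 - conjDiag W e := by
      have h2 : Matrix.diagonal (fun x => ((1 - e x : ℝ) : ℂ)) =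
          1 - Matrix.diagonal fun x => ((e x : ℝ) : ℂ) := by
        rw [← Matrix.diagonal_one, Matrix.diagonal_sub]
        congr 1
        ext x
        push_cast
        rfl
      simp only [conjDiag]
      rw [h2, Matrix.mul_sub, Matrix.sub_mul, mul_one, mul_eq_one_comm.mp hW]
    rw [hWW, ← tensorMul_one_one]
    ext i j
    simp only [tensorMul, Matrix.sub_apply]
    ring
  refine ⟨tensorMul (conjDiag W e) 1, ?_, ?_, fun ρ hρ => ?_, fun σ hσ => ?_⟩
  · rw [hT]
    exact conjDiag_posSemidef _ fun i => he0 _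
  · rw [hsub, hT]
    exact conjDiag_posSemidef _ fun i => he1 _
  · rw [hsub, trace_mul_tensorMul]
    have hρ' := condReduce_one_mem hA hQIV (Nat.mul_pos hK hm) hρ
    set ρ' := condReduce ρ (1 : MatN ι r)
    have h1 : (ρ' * conjDiag W fun i => 1 - e i).trace.re ≤
        (ρ' * conjDiag W fun i => Real.exp (-(m * (η * γ / 2))) * copyProd g m i).trace.re := by
      refine trace_mul_conjDiag_re_mono (hA _ ρ' hρ').1 W fun i => ?_
      have h2 := copyProd_mono (fun x => (Real.exp_pos _).le) hgexp m i
      rw [copyProd_exp, copySum_affine] at h2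
      simp only [he]
      split_ifs with hi
      · rw [sub_zero]
        calc (1 : ℝ) ≤ Real.exp (-(m * (η * γ / 2))) *
              Real.exp (-η * copySum h m i + m * (η * c - η * γ / 2)) := by
              rw [← Real.exp_add]
              refine Real.one_le_exp ?_
              nlinarith
          _ ≤ _ := mul_le_mul_of_nonneg_left h2.2 (Real.exp_pos _).le
      · rw [sub_self]
        exact mul_nonneg (Real.exp_pos _).le ((Real.exp_pos _).le.trans h2.2)
    refine h1.trans ?_
    rw [trace_mul_conjDiag_re_smul, hWdef, ← copyPow_conjDiag]
    exact (mul_le_mul_of_nonneg_left (hle m ρ' hρ') (Real.exp_pos _).le).trans_eq (mul_one _)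
  · rw [tensorPow_add, tensorMul_mul, trace_tensorMul, mul_one, (hσ.tensorPow r).2, mul_one]
    have h1 : (tensorPow σ (K * m) * conjDiag W e).trace.re ≤
        (tensorPow σ (K * m) * conjDiag W fun i => Real.exp (-(m * (c - γ))) *
          copyProd (fun x => Real.exp (h x)) m i).trace.re := by
      refine trace_mul_conjDiag_re_mono (hσ.tensorPow _).1 W fun i => ?_
      rw [copyProd_exp, ← Real.exp_add]
      simp only [he]
      split_ifs with hi
      · exact (Real.exp_pos _).le
      · refine Real.one_le_exp ?_
        linarith [not_lt.mp hi]
    refine h1.trans ?_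
    rw [trace_mul_conjDiag_re_smul, hWdef, ← copyPow_conjDiag, trace_tensorPow_mul_copyPow]
    have him := trace_mul_im_eq_zero (hσ.tensorPow K).1.1
      (conjDiag_isHermitian U fun x => Real.exp (h x))
    rw [Complex.ext (z := (tensorPow σ K * conjDiag U fun x => Real.exp (h x)).trace)
      (w := (((tensorPow σ K * conjDiag U fun x => Real.exp (h x)).trace.re : ℝ) : ℂ)) rfl
      (by rw [him, Complex.ofReal_im]), ← Complex.ofReal_pow, Complex.ofReal_re, Complex.ofReal_re]

end BlockPower

section TypeII
variable {ι : Type*} [Fintype ι] [DecidableEq ι] {n : ℕ} {C : Set (MatC ι)}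

lemma trace_mul_re_le_one {κ : Type*} [Fintype κ] [DecidableEq κ] {σ E : Matrix κ κ ℂ}
    (hσ : IsState σ) (hE : (1 - E).PosSemidef) : (σ * E).trace.re ≤ 1 := by
  have h := trace_mul_re_nonneg hσ.1 hE
  rw [Matrix.mul_sub, mul_one, Matrix.trace_sub, hσ.2, Complex.sub_re, Complex.one_re] at h
  linarith

lemma typeII_le_of_test {A : Set (MatN ι n)} (hC : ∀ σ ∈ C, IsState σ) {ε b : ℝ} {E : MatN ι n}
    (hE : E.PosSemidef) (hE' : (1 - E).PosSemidef) (hA : ∀ ρ ∈ A, (ρ * (1 - E)).trace.re ≤ ε)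
    (hb0 : 0 ≤ b) (hb : ∀ σ ∈ C, (tensorPow σ n * E).trace.re ≤ b) :
    typeII A (iidSet C n) ε ≤ b := by
  refine le_trans (csInf_le (a := sSup {x : ℝ | ∃ σ ∈ iidSet C n, x = (σ * E).trace.re})
    ⟨0, ?_⟩ ⟨E, hE, hE', hA, rfl⟩) (Real.sSup_le ?_ hb0)
  · rintro _ ⟨E, hE, -, -, rfl⟩
    refine Real.sSup_nonneg ?_
    rintro _ ⟨_, ⟨σ, hσ, rfl⟩, rfl⟩
    exact trace_mul_re_nonneg ((hC σ hσ).tensorPow n).1 hE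
  · rintro _ ⟨_, ⟨σ, hσ, rfl⟩, rfl⟩
    exact hb σ hσ

lemma le_typeII_of_iidMix {A : Set (MatN ι n)} (hC : ∀ σ ∈ C, IsState σ) (μ : Measure C)
    [IsProbabilityMeasure μ] {ε t : ℝ} (hε : 0 ≤ ε)
    (ht : ∀ E : MatN ι n, E.PosSemidef → (1 - E).PosSemidef →
      (∀ ρ ∈ A, (ρ * (1 - E)).trace.re ≤ ε) → t ≤ (iidMix μ n * E).trace.re) :
    t ≤ typeII A (iidSet C n) ε := by
  refine le_csInf ⟨_, 1, Matrix.PosSemidef.one, ?_, fun ρ _ => ?_, rfl⟩ ?_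
  · rw [sub_self]
    exact Matrix.PosSemidef.zero
  · rw [sub_self, mul_zero, Matrix.trace_zero]
    exact hε
  rintro _ ⟨E, hE, hE', hA, rfl⟩
  refine (ht E hE hE' hA).trans ?_
  rw [trace_iidMix_mul_re hC]
  have hbdd : BddAbove {x : ℝ | ∃ σ ∈ iidSet C n, x = (σ * E).trace.re} := by
    refine ⟨1, ?_⟩
    rintro _ ⟨_, ⟨σ, hσ, rfl⟩, rfl⟩
    exact trace_mul_re_le_one ((hC σ hσ).tensorPow n) hE'
  refine (integral_mono (integrable_trace_tensorPow_mul hC μ E).re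
    (integrable_const (sSup {x : ℝ | ∃ σ ∈ iidSet C n, x = (σ * E).trace.re})) fun σ => ?_).trans ?_
  · exact le_csSup hbdd ⟨_, ⟨σ, σ.2, rfl⟩, rfl⟩
  · simp

lemma neg_le_negLog_of_le_exp {x s : ℝ} (h : x ≤ Real.exp s) : ((-s : ℝ) : EReal) ≤ negLog x := by
  unfold negLog
  split_ifs with hx
  · exact le_top
  · have := (Real.log_le_iff_le_exp (not_le.mp hx)).mpr h
    exact_mod_cast neg_le_neg this

lemma negLog_le_neg_of_exp_le {x s : ℝ} (h : Real.exp s ≤ x) : negLog x ≤ ((-s : ℝ) : EReal) := by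
  have hx : 0 < x := (Real.exp_pos s).trans_le h
  unfold negLog
  rw [if_neg (not_le.mpr hx)]
  exact_mod_cast neg_le_neg ((Real.le_log_iff_exp_le hx).mpr h)

lemma cFrac_mul_le_cFrac_mul (n : ℕ) {a b : EReal} (h : a ≤ b) : cFrac n * a ≤ cFrac n * b := by
  refine mul_le_mul_of_nonneg_left h ?_
  unfold cFrac
  exact_mod_cast (by positivity : (0 : ℝ) ≤ (n : ℝ)⁻¹)

lemma cFrac_mul_coe (n : ℕ) (x : ℝ) : cFrac n * (x : EReal) = (((n : ℝ)⁻¹ * x : ℝ) : EReal) :=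
  (EReal.coe_mul _ _).symm

lemma steinExponent_le_of_frequently {A : ∀ n : ℕ, Set (MatN ι n)}
    (hA : ∀ n : ℕ, ∀ ρ ∈ A n, IsState ρ) (hC : ∀ σ ∈ C, IsState σ) (μ : Measure C)
    [IsProbabilityMeasure μ] {y : ℝ}
    (hy : ∃ᶠ n : ℕ in atTop, cFrac n * ⨅ ρ ∈ A n, relEnt ρ (iidMix μ n) < (y : EReal)) :
    steinExponent A (iidSet C) ≤ (y : EReal) := by
  have key : ∀ γ : ℝ, 0 < γ → steinExponent A (iidSet C) ≤ (((1 + γ) * y + γ : ℝ) : EReal) := by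
    intro γ hγ
    set ε : ℝ := γ / (4 * (1 + γ)) with hε
    have hε0 : 0 < ε := by positivity
    have hε1 : ε < 1 := by
      rw [hε, div_lt_one (by positivity)]
      linarith
    refine (iInf₂_le ε ⟨hε0, hε1⟩).trans (liminf_le_of_frequently_le' ?_)
    have hlim : Tendsto (fun n : ℕ => (n : ℝ)⁻¹ * (-(Real.log ε - (1 + γ) * (n * y + 1)))) atTop
        (𝓝 ((1 + γ) * y)) := by
      have h1 : Tendsto (fun n : ℕ => (1 + γ) * y + (n : ℝ)⁻¹ * (1 + γ - Real.log ε)) atTop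
          (𝓝 ((1 + γ) * y + 0 * (1 + γ - Real.log ε))) :=
        tendsto_const_nhds.add ((tendsto_inv_atTop_nhds_zero_nat (𝕜 := ℝ)).mul_const _)
      rw [zero_mul, add_zero] at h1
      refine h1.congr' ?_
      filter_upwards [eventually_gt_atTop 0] with n hn
      have : (n : ℝ) ≠ 0 := by positivity
      field_simp
      ring
    refine (hy.and_eventually ((hlim.eventually (ge_mem_nhds (lt_add_of_pos_right _ hγ))).and
      (eventually_gt_atTop 0))).mono ?_
    rintro n ⟨hn, hn', hn0⟩
    have hnR : (n : ℝ) ≠ 0 := by positivity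
    have h1 : ⨅ ρ ∈ A n, relEnt ρ (iidMix μ n) < ((n * y : ℝ) : EReal) := by
      by_contra! h
      refine absurd hn (not_lt.mpr ?_)
      have := cFrac_mul_le_cFrac_mul n h
      rwa [cFrac_mul_coe, inv_mul_cancel_left₀ hnR] at this
    obtain ⟨ρ, h1⟩ := iInf_lt_iff.mp h1
    obtain ⟨hρ, h1⟩ := iInf_lt_iff.mp h1
    have h2 : Real.exp (Real.log ε - (1 + γ) * (n * y + 1)) ≤ typeII (A n) (iidSet C n) ε := by
      refine le_typeII_of_iidMix hC μ hε0.le fun E hE hE' hEA => ?_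
      have h3 := weak_converse (hA n ρ hρ) (isState_iidMix hC μ n) h1.le hγ hE hE'
      have h4 : γ / (2 * (1 + γ)) = 2 * ε := by
        rw [hε]
        field_simp
        norm_num
      have h5 : ε ≤ Real.exp ((1 + γ) * (n * y + 1)) * (iidMix μ n * E).trace.re := by
        linarith [hEA ρ hρ]
      rw [Real.exp_sub, Real.exp_log hε0, div_le_iff₀ (Real.exp_pos _), mul_comm]
      exact h5
    refine (cFrac_mul_le_cFrac_mul n (negLog_le_neg_of_exp_le h2)).trans ?_
    rw [cFrac_mul_coe]
    exact_mod_cast hn'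
  have hlim : Tendsto (fun γ : ℝ => (((1 + γ) * y + γ : ℝ) : EReal)) (𝓝[>] 0) (𝓝 (y : EReal)) := by
    have h1 : Tendsto (fun γ : ℝ => (1 + γ) * y + γ) (𝓝 0) (𝓝 ((1 + 0) * y + 0)) :=
      (by fun_prop : Continuous fun γ : ℝ => (1 + γ) * y + γ).tendsto 0
    rw [add_zero, add_zero, one_mul] at h1
    exact (continuous_coe_real_ereal.tendsto y).comp (h1.mono_left nhdsWithin_le_nhds)
  exact ge_of_tendsto hlim (eventually_mem_nhdsWithin.mono fun γ hγ => key γ hγ)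

lemma le_steinExponent {A : ∀ n : ℕ, Set (MatN ι n)} (hA : ∀ n : ℕ, ∀ ρ ∈ A n, IsState ρ)
    (hAc : ∀ n : ℕ, IsClosed (A n)) (hAconv : ∀ n : ℕ, Convex ℝ (A n))
    (hQIII : AxiomQIII A) (hQIV : AxiomQIV A) (hC : ∀ σ ∈ C, IsState σ) (μ : Measure C)
    [IsProbabilityMeasure μ] {K : ℕ} (hK : 1 ≤ K) (hne : (A K).Nonempty) {P : ℝ} (hP : 0 < P)
    (hμ : ∀ σ ∈ C, ∀ X : MatN ι K, X.PosSemidef →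
      (tensorPow σ K * X).trace.re ≤ P * (iidMix μ K * X).trace.re) {c : ℝ}
    (hc : (c : EReal) < ⨅ ρ ∈ A K, relEnt ρ (iidMix μ K)) {γ : ℝ} (hγ : 0 < γ) :
    (((K : ℝ)⁻¹ * (c - Real.log ((K + 1 : ℝ) ^ (Fintype.card ι * Fintype.card ι)) - γ -
      Real.log P) : ℝ) : EReal) ≤ steinExponent A (iidSet C) := by
  have hω := isState_iidMix hC μ K
  set ω := iidMix μ K with hωdef
  set N : ℝ := (K + 1 : ℝ) ^ (Fintype.card ι * Fintype.card ι) with hN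
  obtain ⟨U₀, w₀, hU₀, -, hωd⟩ := exists_conjDiag_nonneg hω.1
  have hcard : ((Finset.univ.image w₀).card : ℝ) ≤ N := by
    have := card_image_le_of_permCopies hU₀ (w := w₀) fun π => by
      rw [← hωd]
      exact permCopies_iidMix μ π
    rw [hN]
    exact_mod_cast this
  have hpos : 0 < (Finset.univ.image w₀).card := by
    rw [Finset.card_pos, Finset.image_nonempty]
    by_contra h
    have htr := hω.2
    rw [Finset.not_nonempty_iff_eq_empty] at h
    simp only [Matrix.trace, h, Finset.sum_empty] at htr
    exact zero_ne_one htr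
  obtain ⟨H, ⟨U, h, w, hU, rfl, hωU, hw⟩, hH⟩ := exists_isScore_forall (hAc K) (hAconv K) hne
    (hA K) hω.1 (c := c - Real.log N) fun ρ hρ => by
      have h1 : (c : EReal) < relEnt ρ (conjDiag U₀ w₀) := by
        rw [← hωd]
        exact hc.trans_le (iInf₂_le ρ hρ)
      obtain ⟨H, hH, hlt⟩ := exists_isScore_gt (hA K ρ hρ) hU₀ w₀ (hωd ▸ hω) rfl h1
      rw [← hωd] at hH
      refine ⟨H, hH, lt_of_le_of_lt ?_ hlt⟩
      exact sub_le_sub_left (Real.log_le_log (by exact_mod_cast hpos) hcard) _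
  obtain ⟨δ, hδ, htest⟩ := exists_chernoff_test hA hQIII hQIV hK hU h hγ fun ρ hρ => (hH ρ hρ).le
  set R : ℝ := c - Real.log N - γ - Real.log P with hR
  have hexp : ∀ σ ∈ C, (tensorPow σ K * conjDiag U fun x => Real.exp (h x)).trace.re ≤ P := by
    intro σ hσ
    refine (hμ σ hσ _ (conjDiag_posSemidef U fun x => (Real.exp_pos _).le)).trans ?_
    rw [hωU, conjDiag_mul_conjDiag hU, trace_conjDiag hU, Complex.ofReal_re]
    exact (mul_le_mul_of_nonneg_left hw hP.le).trans_eq (mul_one _)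
  have hKR : (0 : ℝ) < K := by exact_mod_cast hK
  refine le_iInf₂ fun ε hε => ?_
  have hlim : Tendsto (fun n : ℕ => (((K : ℝ)⁻¹ * R - (n : ℝ)⁻¹ * |R| : ℝ) : EReal)) atTop
      (𝓝 (((K : ℝ)⁻¹ * R : ℝ) : EReal)) := by
    have h1 : Tendsto (fun n : ℕ => (K : ℝ)⁻¹ * R - (n : ℝ)⁻¹ * |R|) atTop
        (𝓝 ((K : ℝ)⁻¹ * R - 0 * |R|)) :=
      tendsto_const_nhds.sub ((tendsto_inv_atTop_nhds_zero_nat (𝕜 := ℝ)).mul_const _)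
    rw [zero_mul, sub_zero] at h1
    exact (continuous_coe_real_ereal.tendsto _).comp h1
  have hdiv : Tendsto (fun n : ℕ => n / K) atTop atTop := Nat.tendsto_div_const_atTop (by omega)
  have hsmall : ∀ᶠ n : ℕ in atTop, Real.exp (-((n / K : ℕ) * δ)) ≤ ε := by
    have h1 : Tendsto (fun m : ℕ => Real.exp (-((m : ℝ) * δ))) atTop (𝓝 0) :=
      Real.tendsto_exp_neg_atTop_nhds_zero.comp
        (tendsto_natCast_atTop_atTop.atTop_mul_const hδ)
    exact (h1.comp hdiv).eventually (ge_mem_nhds hε.1)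
  rw [← hlim.liminf_eq]
  refine liminf_le_liminf ?_
  filter_upwards [hsmall, hdiv.eventually_ge_atTop 1, eventually_gt_atTop 0] with n hn hm hn0
  obtain ⟨m, r, hr, hmn, rfl⟩ : ∃ m r, r < K ∧ n / K = m ∧ n = K * m + r :=
    ⟨n / K, n % K, Nat.mod_lt _ hK, rfl, (Nat.div_add_mod n K).symm⟩
  rw [hmn] at hn hm
  obtain ⟨E, hE, hE', hI, hII⟩ := htest m r hm
  have h1 : typeII (A (K * m + r)) (iidSet C (K * m + r)) ε ≤ Real.exp (-(m * R)) := by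
    refine typeII_le_of_test hC hE hE' (fun ρ hρ => (hI ρ hρ).trans hn) (Real.exp_pos _).le
      fun σ hσ => (hII σ (hC σ hσ)).trans ?_
    have h2 : Real.exp (-(m * R)) = Real.exp (-(m * (c - Real.log N - γ))) * P ^ m := by
      rw [← Real.exp_log hP, ← Real.exp_nat_mul, ← Real.exp_add, hR]
      congr 1
      ring
    rw [h2]
    refine mul_le_mul_of_nonneg_left (pow_le_pow_left₀ ?_ (hexp σ hσ) m) (Real.exp_pos _).le
    exact trace_mul_re_nonneg ((hC σ hσ).tensorPow K).1
      (conjDiag_posSemidef U fun x => (Real.exp_pos _).le)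
  refine le_trans ?_ (cFrac_mul_le_cFrac_mul _ (neg_le_negLog_of_le_exp h1))
  rw [cFrac_mul_coe, neg_neg, EReal.coe_le_coe_iff]
  set n : ℕ := K * m + r with hn_def
  have hnR : (0 : ℝ) < n := by exact_mod_cast hn0
  have h3 : (n : ℝ) = K * m + r := by rw [hn_def]; push_cast; ring
  have hrK : (r : ℝ) * |R| ≤ K * |R| :=
    mul_le_mul_of_nonneg_right (by exact_mod_cast hr.le) (abs_nonneg R)
  have hrR : (r : ℝ) * R ≤ r * |R| := mul_le_mul_of_nonneg_left (le_abs_self R) (by positivity)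
  have h4 : (K : ℝ)⁻¹ * R - (n : ℝ)⁻¹ * |R| = (n * R - K * |R|) / (K * n) := by
    field_simp
  have h5 : (n : ℝ)⁻¹ * (m * R) = (K * m * R) / (K * n) := by
    field_simp
  rw [h4, h5]
  refine div_le_div_of_nonneg_right ?_ (by positivity)
  rw [h3]
  linarith

end TypeII

section Limit

lemma tendsto_inv_mul_log_pow (a b : ℝ) :
    Tendsto (fun K : ℕ => (K : ℝ)⁻¹ * (a + b * Real.log (K + 1))) atTop (𝓝 0) := by
  have h0 := tendsto_inv_atTop_nhds_zero_nat (𝕜 := ℝ)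
  have h1 : Tendsto (fun K : ℕ => Real.log ((K : ℝ) + 1) / ((K : ℝ) + 1)) atTop (𝓝 0) :=
    Real.isLittleO_log_id_atTop.tendsto_div_nhds_zero.comp
      (tendsto_atTop_add_const_right _ _ tendsto_natCast_atTop_atTop)
  have h2 : Tendsto (fun K : ℕ => (K : ℝ)⁻¹ * a +
      b * (Real.log ((K : ℝ) + 1) / ((K : ℝ) + 1) * (1 + (K : ℝ)⁻¹))) atTop
      (𝓝 (0 * a + b * (0 * (1 + 0)))) :=
    (h0.mul_const a).add ((h1.mul (h0.const_add 1)).const_mul b)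
  simp only [zero_mul, mul_zero, add_zero] at h2
  refine h2.congr' ?_
  filter_upwards [eventually_gt_atTop 0] with K hK
  have : (0 : ℝ) < K := by exact_mod_cast hK
  field_simp

lemma AxiomQI.nonempty {ι : Type*} [Fintype ι] [DecidableEq ι] {A : ∀ n : ℕ, Set (MatN ι n)}
    (hQI : AxiomQI A) (hQII : AxiomQII A) {n : ℕ} (hn : 1 ≤ n) : (A n).Nonempty := by
  obtain ⟨τ, hτ, -⟩ := hQI
  have h : (A (n * 1)).Nonempty := ⟨_, hQII n 1 hn le_rfl _ hτ⟩
  rwa [mul_one] at h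

end Limit

/-- **Generalised quantum Sanov theorem revisited (i.i.d. alternative).**
`Stein(𝒜‖ℬ₁^{iid}) = min*_{μ∈𝒫(ℬ₁)} lim_n (1/n) inf_{ρ_n∈𝒜_n} D(ρ_n‖∫dμ(σ) σ^{⊗n})`. -/
theorem generalised_quantum_Sanov_iid (d : ℕ)
    (A : ∀ n : ℕ, Set (MatN (Fin d) n))
    (hA_states : ∀ n : ℕ, ∀ ρ ∈ A n, IsState ρ)
    (hA_closed : ∀ n : ℕ, IsClosed (A n))
    (hA_convex : ∀ n : ℕ, Convex ℝ (A n))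
    (hQI : AxiomQI A) (hQII : AxiomQII A) (hQIII : AxiomQIII A) (hQIV : AxiomQIV A)
    (B1 : Set (MatC (Fin d)))
    (hB_states : ∀ σ ∈ B1, IsState σ)
    (hB_ne : B1.Nonempty) (hB_closed : IsClosed B1) :
    ∃ S : EReal,
      steinExponent A (iidSet B1) = S ∧
      (∃ μ : Measure ↥B1, IsProbabilityMeasure μ ∧
        Filter.Tendsto (fun n : ℕ => cFrac n * ⨅ ρ ∈ A n, relEnt ρ (iidMix μ n))
          Filter.atTop (nhds S)) ∧
      (∀ μ : Measure ↥B1, IsProbabilityMeasure μ → ∀ L : EReal,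
        Filter.Tendsto (fun n : ℕ => cFrac n * ⨅ ρ ∈ A n, relEnt ρ (iidMix μ n))
          Filter.atTop (nhds L) → S ≤ L) := by
  refine ⟨_, rfl, ?_, fun μ hμ L hL => ?_⟩
  · obtain ⟨μ, hμ, M, hM, D, hdom⟩ := exists_universal_measure hB_states hB_closed hB_ne
    refine ⟨μ, hμ, tendsto_order.mpr ⟨fun a ha => ?_, fun b hb => ?_⟩⟩
    · obtain ⟨y, hay, hyS⟩ := EReal.lt_iff_exists_real_btwn.mp ha
      by_contra h
      rw [not_eventually] at h
      exact absurd hyS (not_lt.mpr (steinExponent_le_of_frequently hA_states hB_states μ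
        (h.mono fun n hn => (not_lt.mp hn).trans_lt hay)))
    · obtain ⟨z, hSz, hzb⟩ := EReal.lt_iff_exists_real_btwn.mp hb
      obtain ⟨y, hzy, hyb⟩ := EReal.lt_iff_exists_real_btwn.mp hzb
      rw [EReal.coe_lt_coe_iff] at hzy
      by_contra h
      rw [not_eventually] at h
      set q := Fintype.card (Fin d) * Fintype.card (Fin d) with hq
      have hlim := (tendsto_inv_mul_log_pow (1 + Real.log M) (q + D)).eventually
        (gt_mem_nhds (sub_pos.mpr hzy))
      obtain ⟨K, hK, hKlim, hK0⟩ := (h.and_eventually (hlim.and (eventually_gt_atTop 0))).exists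
      have hKR : (0 : ℝ) < K := by exact_mod_cast hK0
      have hK1 : (0 : ℝ) < (K : ℝ) + 1 := by positivity
      have hc : ((K * y : ℝ) : EReal) < ⨅ ρ ∈ A K, relEnt ρ (iidMix μ K) := by
        by_contra! h'
        have h1 := cFrac_mul_le_cFrac_mul K h'
        rw [cFrac_mul_coe, inv_mul_cancel_left₀ hKR.ne'] at h1
        exact hK (h1.trans_lt hyb)
      have hle := le_steinExponent hA_states hA_closed hA_convex hQIII hQIV hB_states μ hK0
        (hQI.nonempty hQII hK0) (P := M * (K + 1 : ℝ) ^ D) (by positivity)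
        (fun σ hσ X hX => hdom K σ hσ X hX) hc one_pos
      refine absurd hSz (not_lt.mpr (le_trans ?_ hle))
      rw [EReal.coe_le_coe_iff, Real.log_mul hM.ne' (by positivity), Real.log_pow, Real.log_pow]
      have h2 : (K : ℝ)⁻¹ * (K * y - (q : ℕ) * Real.log (K + 1) - 1 -
          (Real.log M + D * Real.log (K + 1))) =
          y - (K : ℝ)⁻¹ * (1 + Real.log M + (q + D) * Real.log (K + 1)) := by
        field_simp
        ring
      rw [h2]
      linarith
  · by_contra! h
    obtain ⟨y, hLy, hyS⟩ := EReal.lt_iff_exists_real_btwn.mp h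
    exact absurd hyS (not_lt.mpr (steinExponent_le_of_frequently hA_states hB_states μ
      (hL.eventually (gt_mem_nhds hLy)).frequently))

end QSanov
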